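/- arXiv:math/0503002 — 3 statements merged into one kernel-verified Lean document; each statement's English description precedes it below -/
import Mathlib

section
/- Littlewood's identity for even-column partitions: Σ_{λ : λ' even} s_λ(α_1,...,α_n) = ∏_{1 ≤ i < j ≤ n} 1/(1 - α_i α_j), where the sum is over all partitions λ with at most n parts whose conjugate λ' has all parts even. -/
open scoped Classical

noncomputable section

/-- Cells of the Young diagram of `f : Fin r → ℕ` (viewed as a partition with at most
`r` parts, row `i` having length `f i`). -/
def pcells {r : ℕ} (f : Fin r → ℕ) : Finset (Fin r × ℕ) :=
  (Finset.univ ×ˢ Finset.range (Finset.univ.sup f)).filter (fun p => p.2 < f p.1)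

/-- `T` is a semistandard filling of the diagram of `f` with entries in `Fin n`:
rows weakly increase, columns strictly increase. -/
def IsSSYT {r n : ℕ} (f : Fin r → ℕ) (T : {x // x ∈ pcells f} → Fin n) : Prop :=
  (∀ p q : {x // x ∈ pcells f},
      p.val.1 = q.val.1 → p.val.2 ≤ q.val.2 → T p ≤ T q) ∧
  (∀ p q : {x // x ∈ pcells f},
      p.val.2 = q.val.2 → p.val.1 < q.val.1 → T p < T q)

/-- The Schur polynomial `s_f(x_1, …, x_n)`, defined combinatorially as the sum over
semistandard Young tableaux of shape `f` with entries in `{1, …, n}` of their weights. -/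
def schurPoly {r : ℕ} (f : Fin r → ℕ) (n : ℕ) : MvPolynomial (Fin n) ℤ :=
  ∑ T ∈ Finset.univ.filter (fun T : {x // x ∈ pcells f} → Fin n => IsSSYT f T),
    ∏ c : {x // x ∈ pcells f}, MvPolynomial.X (T c)

/-- The `j`-th part (`j` counted from `0`) of the conjugate of the partition `f`. -/
def conjPart {r : ℕ} (f : Fin r → ℕ) (j : ℕ) : ℕ :=
  (Finset.univ.filter (fun i => j < f i)).card

/-- The finset of partitions with at most `n` parts and size at most `m`. -/
def partitionsLE (n m : ℕ) : Finset (Fin n → ℕ) :=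
  (Fintype.piFinset fun _ => Finset.range (m + 1)).filter
    (fun f => (∀ i j : Fin n, i ≤ j → f j ≤ f i) ∧ ∑ i, f i ≤ m)

/-- `Interlaces l m` says that `l / m` is a horizontal strip: `l 0 ≥ m 0 ≥ l 1 ≥ m 1 ≥ ⋯`. -/
def Interlaces (l m : ℕ →₀ ℕ) : Prop := ∀ i, m i ≤ l i ∧ l (i + 1) ≤ m i

/-- The partitions `m` such that `l / m` is a horizontal strip. -/
def stripsBelow (l : ℕ →₀ ℕ) : Finset (ℕ →₀ ℕ) := (Finset.Iic l).filter (Interlaces l)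

/-- The partitions of `m`, as finitely supported antitone sequences. -/
def partitionsOf (m : ℕ) : Finset (ℕ →₀ ℕ) :=
  (Finset.finsuppAntidiag (Finset.range m) m).filter (fun f => Antitone f)

/-- The partitions `l` such that `l / m` is a horizontal strip of size `a`. -/
def stripsAbove (m : ℕ →₀ ℕ) (a : ℕ) : Finset (ℕ →₀ ℕ) :=
  (partitionsOf (m.degree + a)).filter (fun l => Interlaces l m)

lemma Interlaces.le {l m : ℕ →₀ ℕ} (h : Interlaces l m) : m ≤ l := fun i => (h i).1

lemma Interlaces.antitone {l m : ℕ →₀ ℕ} (h : Interlaces l m) : Antitone l :=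
  antitone_nat_of_succ_le fun i => (h i).2.trans (h i).1

lemma Interlaces.antitone_right {l m : ℕ →₀ ℕ} (h : Interlaces l m) : Antitone m :=
  antitone_nat_of_succ_le fun i => (h (i + 1)).1.trans (h i).2

lemma mem_stripsBelow {l m : ℕ →₀ ℕ} : m ∈ stripsBelow l ↔ Interlaces l m := by
  simp only [stripsBelow, Finset.mem_filter, Finset.mem_Iic, and_iff_right_iff_imp]
  exact Interlaces.le

lemma exists_forall_ge_eq_zero (f : ℕ →₀ ℕ) : ∃ N, ∀ i, N ≤ i → f i = 0 := by
  refine ⟨f.support.sup id + 1, fun i hi => ?_⟩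
  by_contra h
  have := Finset.le_sup (f := id) (Finsupp.mem_support_iff.2 h)
  simp only [id] at this
  omega

lemma degree_eq_sum_range (f : ℕ →₀ ℕ) {N : ℕ} (h : ∀ i, N ≤ i → f i = 0) :
    f.degree = ∑ i ∈ Finset.range N, f i := by
  rw [Finsupp.degree_apply]
  refine Finset.sum_subset (fun i hi => ?_) (fun i _ hi => by simpa using hi)
  by_contra hN
  exact (Finsupp.mem_support_iff.1 hi) (h i (by simpa using hN))

lemma mem_partitionsOf {m : ℕ} {f : ℕ →₀ ℕ} :
    f ∈ partitionsOf m ↔ Antitone f ∧ f.degree = m := by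
  rw [partitionsOf, Finset.mem_filter, Finset.mem_finsuppAntidiag', and_comm,
    and_congr_right_iff]
  intro hf
  refine ⟨fun h => h.1, fun h => ⟨h, fun i hi => ?_⟩⟩
  have hi : f i ≠ 0 := Finsupp.mem_support_iff.1 hi
  rw [Finset.mem_range]
  have hsub : Finset.range (i + 1) ⊆ f.support := fun j hj => by
    have := hf (Nat.lt_succ_iff.1 (Finset.mem_range.1 hj))
    rw [Finsupp.mem_support_iff]
    omega
  have h1 := Finset.card_nsmul_le_sum f.support f 1 fun j hj =>
    Nat.one_le_iff_ne_zero.2 (Finsupp.mem_support_iff.1 hj)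
  have h2 := Finset.card_le_card hsub
  rw [← Finsupp.degree_apply] at h1
  simp only [Finset.card_range, smul_eq_mul, mul_one] at h1 h2
  omega

lemma mem_stripsAbove {m l : ℕ →₀ ℕ} {a : ℕ} :
    l ∈ stripsAbove m a ↔ Interlaces l m ∧ l.degree = m.degree + a := by
  rw [stripsAbove, Finset.mem_filter, mem_partitionsOf]
  exact ⟨fun h => ⟨h.2, h.1.2⟩, fun h => ⟨⟨h.1.antitone, h.2⟩, h.1⟩⟩

lemma interlaces_add_single {l m : ℕ →₀ ℕ} (h : m 0 ≤ l 0) :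
    Interlaces (l + Finsupp.single 0 1) m ↔ Interlaces l m := by
  refine forall_congr' fun i => ?_
  cases i with
  | zero => simp; omega
  | succ i => simp

lemma degree_add_degree_of_reflect {l r m k : ℕ →₀ ℕ} (h0 : l 0 = max (m 0) (k 0))
    (h : ∀ i, l (i + 1) + r i = min (m i) (k i) + max (m (i + 1)) (k (i + 1))) :
    l.degree + r.degree = m.degree + k.degree := by
  obtain ⟨N₁, h₁⟩ := exists_forall_ge_eq_zero m
  obtain ⟨N₂, h₂⟩ := exists_forall_ge_eq_zero k
  have hm : ∀ i, N₁ + N₂ ≤ i → m i = 0 := fun i hi => h₁ i (by omega)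
  have hk : ∀ i, N₁ + N₂ ≤ i → k i = 0 := fun i hi => h₂ i (by omega)
  generalize N₁ + N₂ = N at hm hk
  have hr : ∀ i, N ≤ i → r i = 0 := fun i hi => by
    have := h i
    rw [hm i hi, hk i hi, hm (i + 1) (by omega), hk (i + 1) (by omega)] at this
    omega
  have hl : ∀ i, N + 1 ≤ i → l i = 0 := fun i hi => by
    obtain ⟨j, rfl⟩ : ∃ j, i = j + 1 := ⟨i - 1, by omega⟩
    have := h j
    rw [hm j (by omega), hk j (by omega), hm (j + 1) (by omega), hk (j + 1) (by omega)] at this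
    omega
  have key : ∀ M, ∑ i ∈ Finset.range (M + 1), l i + ∑ i ∈ Finset.range M, r i =
      ∑ i ∈ Finset.range M, m i + ∑ i ∈ Finset.range M, k i + max (m M) (k M) := by
    intro M
    induction M with
    | zero => simp [h0]
    | succ M ih =>
      rw [Finset.sum_range_succ l, Finset.sum_range_succ r, Finset.sum_range_succ m,
        Finset.sum_range_succ k]
      have := h M
      omega
  have := key N
  rw [hm N le_rfl, hk N le_rfl] at this
  rw [degree_eq_sum_range l hl, degree_eq_sum_range r hr, degree_eq_sum_range m hm,
    degree_eq_sum_range k hk, this]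
  simp

/-- The lower reflection of `l`, a common lower neighbour of `m` and `k` when `l` is a common
upper neighbour. -/
def reflectDown (m k l : ℕ →₀ ℕ) : ℕ →₀ ℕ :=
  Finsupp.ofSupportFinite
    (fun i => min (m i) (k i) + max (m (i + 1)) (k (i + 1)) - l (i + 1)) <| by
      obtain ⟨N₁, h₁⟩ := exists_forall_ge_eq_zero m
      obtain ⟨N₂, h₂⟩ := exists_forall_ge_eq_zero k
      refine (Finset.range (N₁ + N₂)).finite_toSet.subset fun i hi => ?_
      by_contra hN
      simp only [Finset.coe_range, Set.mem_Iio, not_lt] at hN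
      refine hi ?_
      simp [h₁ i (by omega), h₁ (i + 1) (by omega), h₂ (i + 1) (by omega)]

/-- The upper reflection of `r`, a common upper neighbour of `m` and `k` when `r` is a common
lower neighbour. -/
def reflectUp (m k r : ℕ →₀ ℕ) : ℕ →₀ ℕ :=
  Finsupp.ofSupportFinite
    (fun i => match i with
      | 0 => max (m 0) (k 0)
      | i + 1 => min (m i) (k i) + max (m (i + 1)) (k (i + 1)) - r i) <| by
      obtain ⟨N₁, h₁⟩ := exists_forall_ge_eq_zero m
      obtain ⟨N₂, h₂⟩ := exists_forall_ge_eq_zero k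
      refine (Finset.range (N₁ + N₂ + 1)).finite_toSet.subset fun i hi => ?_
      by_contra hN
      simp only [Finset.coe_range, Set.mem_Iio, not_lt] at hN
      refine hi ?_
      obtain ⟨j, rfl⟩ : ∃ j, i = j + 1 := ⟨i - 1, by omega⟩
      simp [h₁ j (by omega), h₁ (j + 1) (by omega), h₂ (j + 1) (by omega)]

lemma reflectDown_apply (m k l : ℕ →₀ ℕ) (i : ℕ) : reflectDown m k l i =
    min (m i) (k i) + max (m (i + 1)) (k (i + 1)) - l (i + 1) := rfl

lemma reflectUp_zero (m k r : ℕ →₀ ℕ) : reflectUp m k r 0 = max (m 0) (k 0) := rfl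

lemma reflectUp_succ (m k r : ℕ →₀ ℕ) (i : ℕ) : reflectUp m k r (i + 1) =
    min (m i) (k i) + max (m (i + 1)) (k (i + 1)) - r i := rfl

section

variable {A : Type*} [CommRing A] (x : ℕ → A)

/-- The Schur function of `l` in the variables `x 0, …, x (n - 1)`, defined by the branching
rule. -/
def branchSchur : ℕ → (ℕ →₀ ℕ) → A
  | 0, l => if l = 0 then 1 else 0
  | n + 1, l => ∑ m ∈ stripsBelow l, x n ^ (l.degree - m.degree) * branchSchur n m

/-- The complete homogeneous symmetric function of degree `a` in `x 0, …, x (n - 1)`. -/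
def completeHom : ℕ → ℕ → A
  | _, 0 => 1
  | 0, _ + 1 => 0
  | n + 1, a + 1 => completeHom n (a + 1) + x n * completeHom (n + 1) a

lemma sum_tied (n : ℕ) (m : ℕ →₀ ℕ) (a : ℕ) :
    ∑ p ∈ ((stripsAbove m a).sigma stripsBelow).filter
        (fun p : (_ : ℕ →₀ ℕ) × (ℕ →₀ ℕ) => p.1 0 = max (m 0) (p.2 0)),
      x n ^ (p.1.degree - p.2.degree) * branchSchur x n p.2 =
    ∑ r ∈ stripsBelow m, x n ^ (m.degree - r.degree) *
      ∑ k ∈ stripsAbove r a, branchSchur x n k := by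
  simp_rw [Finset.mul_sum]
  rw [Finset.sum_sigma']
  refine Finset.sum_bij' (fun p _ => ⟨reflectDown m p.2 p.1, p.2⟩)
    (fun p _ => ⟨reflectUp m p.2 p.1, p.2⟩) ?_ ?_ ?_ ?_ ?_
  · rintro ⟨l, k⟩ h
    simp only [Finset.mem_filter, Finset.mem_sigma, mem_stripsAbove, mem_stripsBelow] at h ⊢
    obtain ⟨⟨⟨h₁, h₂⟩, h₃⟩, h₄⟩ := h
    have hd := degree_add_degree_of_reflect (r := reflectDown m k l) h₄ fun i => by
      have := h₁ i; have := h₁ (i + 1); have := h₃ i; have := h₃ (i + 1)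
      rw [reflectDown_apply]
      omega
    refine ⟨fun i => ?_, fun i => ?_, by omega⟩ <;>
    · have := h₁ i; have := h₁ (i + 1); have := h₃ i; have := h₃ (i + 1)
      rw [reflectDown_apply]
      omega
  · rintro ⟨r, k⟩ h
    simp only [Finset.mem_filter, Finset.mem_sigma, mem_stripsAbove, mem_stripsBelow] at h ⊢
    obtain ⟨h₁, h₂, h₃⟩ := h
    have hd := degree_add_degree_of_reflect (r := r) (reflectUp_zero m k r) fun i => by
      have := h₁ i; have := h₁ (i + 1); have := h₂ i; have := h₂ (i + 1)
      rw [reflectUp_succ]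
      omega
    refine ⟨⟨⟨fun i => ?_, by omega⟩, fun i => ?_⟩, reflectUp_zero m k r⟩ <;>
    · cases i with
      | zero =>
        have := h₁ 0; have := h₂ 0
        rw [reflectUp_zero, reflectUp_succ]
        omega
      | succ i =>
        have := h₁ i; have := h₁ (i + 1); have := h₂ i; have := h₂ (i + 1)
        rw [reflectUp_succ, reflectUp_succ]
        omega
  · rintro ⟨l, k⟩ h
    simp only [Finset.mem_filter, Finset.mem_sigma, mem_stripsAbove, mem_stripsBelow] at h
    obtain ⟨⟨⟨h₁, h₂⟩, h₃⟩, h₄⟩ := h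
    simp only [Sigma.mk.injEq, heq_eq_eq, and_true]
    ext i
    cases i with
    | zero => rw [reflectUp_zero, h₄]
    | succ i =>
      have := h₁ i; have := h₁ (i + 1); have := h₃ i; have := h₃ (i + 1)
      rw [reflectUp_succ, reflectDown_apply]
      omega
  · rintro ⟨r, k⟩ h
    simp only [Finset.mem_sigma, mem_stripsAbove, mem_stripsBelow] at h
    obtain ⟨h₁, h₂, h₃⟩ := h
    simp only [Sigma.mk.injEq, heq_eq_eq, and_true]
    ext i
    have := h₁ i; have := h₁ (i + 1); have := h₂ i; have := h₂ (i + 1)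
    rw [reflectDown_apply, reflectUp_succ]
    omega
  · rintro ⟨l, k⟩ h
    simp only [Finset.mem_filter, Finset.mem_sigma, mem_stripsAbove, mem_stripsBelow] at h ⊢
    obtain ⟨⟨⟨h₁, h₂⟩, h₃⟩, h₄⟩ := h
    have hd := degree_add_degree_of_reflect (r := reflectDown m k l) h₄ fun i => by
      have := h₁ i; have := h₁ (i + 1); have := h₃ i; have := h₃ (i + 1)
      rw [reflectDown_apply]
      omega
    have := Finsupp.degree_mono h₃.le
    congr 2
    omega

lemma sum_untied_zero (n : ℕ) (m : ℕ →₀ ℕ) :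
    ∑ p ∈ ((stripsAbove m 0).sigma stripsBelow).filter
        (fun p : (_ : ℕ →₀ ℕ) × (ℕ →₀ ℕ) => ¬ p.1 0 = max (m 0) (p.2 0)),
      x n ^ (p.1.degree - p.2.degree) * branchSchur x n p.2 = 0 := by
  rw [Finset.filter_false_of_mem, Finset.sum_empty]
  rintro ⟨l, k⟩ h
  simp only [Finset.mem_sigma, mem_stripsAbove, mem_stripsBelow] at h
  obtain ⟨⟨h₁, h₂⟩, h₃⟩ := h
  obtain ⟨c, rfl⟩ := exists_add_of_le h₁.le
  have hc : c = 0 := by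
    rw [map_add, add_zero, Nat.add_eq_left, Finsupp.degree_eq_zero_iff] at h₂
    exact h₂
  subst hc
  have := (h₃ 0).1
  simp only [not_not]
  simp only [Finsupp.add_apply, Finsupp.zero_apply, Nat.add_zero] at this ⊢
  omega

lemma sum_untied_succ (n : ℕ) (m : ℕ →₀ ℕ) (a : ℕ) :
    ∑ p ∈ ((stripsAbove m (a + 1)).sigma stripsBelow).filter
        (fun p : (_ : ℕ →₀ ℕ) × (ℕ →₀ ℕ) => ¬ p.1 0 = max (m 0) (p.2 0)),
      x n ^ (p.1.degree - p.2.degree) * branchSchur x n p.2 =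
    x n * ∑ l ∈ stripsAbove m a, branchSchur x (n + 1) l := by
  simp_rw [branchSchur, Finset.mul_sum]
  rw [Finset.sum_sigma']
  symm
  refine Finset.sum_bij' (fun p _ => ⟨p.1 + Finsupp.single 0 1, p.2⟩)
    (fun p _ => ⟨p.1 - Finsupp.single 0 1, p.2⟩) ?_ ?_ ?_ ?_ ?_
  · rintro ⟨l, k⟩ h
    simp only [Finset.mem_filter, Finset.mem_sigma, mem_stripsAbove, mem_stripsBelow] at h ⊢
    obtain ⟨⟨h₁, h₂⟩, h₃⟩ := h
    have h₁' := (h₁ 0).1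
    have h₃' := (h₃ 0).1
    refine ⟨⟨⟨(interlaces_add_single h₁').2 h₁, ?_⟩, (interlaces_add_single h₃').2 h₃⟩, ?_⟩
    · simp [h₂, add_assoc]
    · simp only [Finsupp.add_apply, Finsupp.single_eq_same]
      omega
  · rintro ⟨l, k⟩ h
    simp only [Finset.mem_filter, Finset.mem_sigma, mem_stripsAbove, mem_stripsBelow] at h ⊢
    obtain ⟨⟨⟨h₁, h₂⟩, h₃⟩, h₄⟩ := h
    have h₁' := (h₁ 0).1
    have h₃' := (h₃ 0).1
    obtain ⟨c, rfl⟩ : ∃ c, l = c + Finsupp.single 0 1 :=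
      ⟨_, (tsub_add_cancel_of_le <| Finsupp.single_le_iff.2 (by omega)).symm⟩
    simp only [Finsupp.add_apply, Finsupp.single_eq_same] at h₁' h₃' h₄
    rw [add_tsub_cancel_right]
    rw [interlaces_add_single (by omega)] at h₁ h₃
    rw [map_add, Finsupp.degree_single] at h₂
    exact ⟨⟨h₁, by omega⟩, h₃⟩
  · rintro ⟨l, k⟩ h
    simp only [add_tsub_cancel_right]
  · rintro ⟨l, k⟩ h
    simp only [Finset.mem_filter, Finset.mem_sigma, mem_stripsAbove, mem_stripsBelow] at h
    obtain ⟨⟨⟨h₁, h₂⟩, h₃⟩, h₄⟩ := h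
    have h₁' := (h₁ 0).1
    have h₃' := (h₃ 0).1
    simp only
    rw [tsub_add_cancel_of_le (Finsupp.single_le_iff.2 (by omega))]
  · rintro ⟨l, k⟩ h
    simp only [Finset.mem_sigma, mem_stripsAbove, mem_stripsBelow] at h ⊢
    have := Finsupp.degree_mono h.2.le
    rw [map_add, Finsupp.degree_single, Nat.sub_add_comm this, pow_succ]
    ring

lemma sum_stripsAbove_branchSchur_succ (n : ℕ) (m : ℕ →₀ ℕ) (a : ℕ) :
    ∑ l ∈ stripsAbove m a, branchSchur x (n + 1) l =
      ∑ p ∈ ((stripsAbove m a).sigma stripsBelow).filter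
          (fun p : (_ : ℕ →₀ ℕ) × (ℕ →₀ ℕ) => ¬ p.1 0 = max (m 0) (p.2 0)),
        x n ^ (p.1.degree - p.2.degree) * branchSchur x n p.2 +
      ∑ r ∈ stripsBelow m, x n ^ (m.degree - r.degree) *
        ∑ k ∈ stripsAbove r a, branchSchur x n k := by
  rw [← sum_tied, add_comm (Finset.sum _ _), Finset.sum_filter_add_sum_filter_not, Finset.sum_sigma]
  rfl

/-- The Pieri rule. -/
lemma pieri (n : ℕ) (m : ℕ →₀ ℕ) (a : ℕ) :
    ∑ l ∈ stripsAbove m a, branchSchur x n l = completeHom x n a * branchSchur x n m := by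
  induction n generalizing m a with
  | zero =>
    simp only [branchSchur, mul_ite, mul_one, mul_zero]
    rw [Finset.sum_ite_eq']
    simp only [mem_stripsAbove, map_zero]
    cases a with
    | zero =>
      simp only [completeHom, add_zero]
      congr 1
      refine propext ⟨fun h => (Finsupp.degree_eq_zero_iff m).1 h.2.symm, ?_⟩
      rintro rfl
      exact ⟨fun i => by simp, by simp⟩
    | succ a =>
      simp [completeHom]
  | succ n ih =>
    induction a with
    | zero =>
      rw [sum_stripsAbove_branchSchur_succ, sum_untied_zero, zero_add]
      simp_rw [ih, completeHom, one_mul, branchSchur]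
    | succ a iha =>
      rw [sum_stripsAbove_branchSchur_succ, sum_untied_succ, iha]
      simp_rw [ih, completeHom, branchSchur, add_mul, Finset.mul_sum]
      rw [add_comm]
      congr 1
      · exact Finset.sum_congr rfl fun r _ => by ring
      · exact Finset.sum_congr rfl fun r _ => by ring

end

/-- All columns of `l` have even length. -/
def EvenColumns (l : ℕ →₀ ℕ) : Prop := ∀ i, l (2 * i) = l (2 * i + 1)

/-- The sequence `m 0, m 0, m 2, m 2, …`. -/
def evenUp (m : ℕ →₀ ℕ) : ℕ →₀ ℕ :=
  Finsupp.ofSupportFinite (fun i => m (2 * (i / 2))) <| by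
    obtain ⟨N, h⟩ := exists_forall_ge_eq_zero m
    refine (Finset.range (N + 1)).finite_toSet.subset fun i hi => ?_
    by_contra hN
    simp only [Finset.coe_range, Set.mem_Iio, not_lt] at hN
    exact hi (h _ (by omega))

/-- The sequence `m 1, m 1, m 3, m 3, …`. -/
def evenDown (m : ℕ →₀ ℕ) : ℕ →₀ ℕ :=
  Finsupp.ofSupportFinite (fun i => m (2 * (i / 2) + 1)) <| by
    obtain ⟨N, h⟩ := exists_forall_ge_eq_zero m
    refine (Finset.range (N + 1)).finite_toSet.subset fun i hi => ?_
    by_contra hN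
    simp only [Finset.coe_range, Set.mem_Iio, not_lt] at hN
    exact hi (h _ (by omega))

lemma evenUp_apply (m : ℕ →₀ ℕ) (i : ℕ) : evenUp m i = m (2 * (i / 2)) := rfl

lemma evenDown_apply (m : ℕ →₀ ℕ) (i : ℕ) : evenDown m i = m (2 * (i / 2) + 1) := rfl

lemma evenColumns_evenUp (m : ℕ →₀ ℕ) : EvenColumns (evenUp m) := fun i => by
  rw [evenUp_apply, evenUp_apply]
  congr 1
  omega

lemma evenColumns_evenDown (m : ℕ →₀ ℕ) : EvenColumns (evenDown m) := fun i => by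
  rw [evenDown_apply, evenDown_apply]
  congr 1
  omega

lemma interlaces_evenUp {m : ℕ →₀ ℕ} (h : Antitone m) : Interlaces (evenUp m) m := fun i =>
  ⟨h (by omega), h (by omega)⟩

lemma interlaces_evenDown {m : ℕ →₀ ℕ} (h : Antitone m) : Interlaces m (evenDown m) := fun i =>
  ⟨h (by omega), h (by omega)⟩

lemma eq_evenUp {l m : ℕ →₀ ℕ} (h : Interlaces l m) (hl : EvenColumns l) : l = evenUp m := by
  ext i
  have h₁ := h (2 * (i / 2))
  have h₂ := hl (i / 2)
  rw [evenUp_apply]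
  obtain h | h : i = 2 * (i / 2) ∨ i = 2 * (i / 2) + 1 := by omega
  all_goals
    conv_lhs => rw [h]
    omega

lemma eq_evenDown {l m : ℕ →₀ ℕ} (h : Interlaces m l) (hl : EvenColumns l) : l = evenDown m := by
  ext i
  have h₁ := h (2 * (i / 2))
  have h₃ := h (2 * (i / 2) + 1)
  have h₂ := hl (i / 2)
  rw [evenDown_apply]
  obtain h | h : i = 2 * (i / 2) ∨ i = 2 * (i / 2) + 1 := by omega
  all_goals
    conv_lhs => rw [h]
    omega

lemma degree_evenUp_add_degree_evenDown (m : ℕ →₀ ℕ) :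
    (evenUp m).degree + (evenDown m).degree = 2 * m.degree := by
  obtain ⟨N, h⟩ := exists_forall_ge_eq_zero m
  rw [degree_eq_sum_range m (N := 2 * N) fun i hi => h i (by omega),
    degree_eq_sum_range (evenUp m) (N := 2 * N) fun i hi => h _ (by omega),
    degree_eq_sum_range (evenDown m) (N := 2 * N) fun i hi => h _ (by omega)]
  clear h
  induction N with
  | zero => simp
  | succ N ih =>
    simp only [Nat.mul_succ, Finset.sum_range_succ, evenUp_apply, evenDown_apply] at ih ⊢
    have e₁ : 2 * (2 * N / 2) = 2 * N := by omega
    have e₂ : 2 * ((2 * N + 1) / 2) = 2 * N := by omega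
    rw [e₁, e₂]
    omega

section

variable {A : Type*} [CommRing A] (x : ℕ → A)

/-- The sum of the Schur functions in `x 0, …, x (n - 1)` over the partitions of `m` with even
columns. -/
def evenSchurSum (n m : ℕ) : A :=
  ∑ l ∈ (partitionsOf m).filter EvenColumns, branchSchur x n l

/-- The series `∑ a, h_a y ^ a q ^ (2 * a)`, where `h_a` is the complete homogeneous symmetric
function in `x 0, …, x (n - 1)`. -/
def completeSeries (y : A) (n : ℕ) : PowerSeries A :=
  PowerSeries.mk fun m => if Even m then y ^ (m / 2) * completeHom x n (m / 2) else 0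

lemma mk_evenSchurSum_succ (n : ℕ) :
    PowerSeries.mk (evenSchurSum x (n + 1)) =
      completeSeries x (x n) n * PowerSeries.mk (evenSchurSum x n) := by
  ext m
  rw [PowerSeries.coeff_mul]
  simp only [PowerSeries.coeff_mk, completeSeries, ite_mul, zero_mul]
  rw [← Finset.sum_filter]
  simp only [evenSchurSum, Finset.mul_sum]
  simp_rw [mul_assoc, ← pieri, branchSchur, Finset.mul_sum]
  rw [Finset.sum_sigma', Finset.sum_sigma', Finset.sum_sigma']
  refine Finset.sum_bij'
    (fun p _ => ⟨⟨(2 * (p.1.degree - p.2.degree), (evenDown p.2).degree), evenDown p.2⟩, p.2⟩)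
    (fun p _ => ⟨evenUp p.2, p.2⟩) ?_ ?_ ?_ ?_ ?_
  · rintro ⟨l, k⟩ h
    simp only [Finset.mem_filter, Finset.mem_sigma, mem_stripsAbove, mem_stripsBelow,
      mem_partitionsOf, Finset.HasAntidiagonal.mem_antidiagonal] at h ⊢
    obtain ⟨⟨⟨h₁, h₂⟩, h₃⟩, h₄⟩ := h
    have hk := h₄.antitone_right
    have hd := degree_evenUp_add_degree_evenDown k
    have hle := Finsupp.degree_mono h₄.le
    have hle' := Finsupp.degree_mono (interlaces_evenDown hk).le
    rw [← eq_evenUp h₄ h₃] at hd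
    exact ⟨⟨⟨by omega, even_two_mul _⟩, ⟨(interlaces_evenDown hk).antitone_right, trivial⟩,
      evenColumns_evenDown k⟩, interlaces_evenDown hk, by omega⟩
  · rintro ⟨⟨⟨a, b⟩, l⟩, k⟩ h
    simp only [Finset.mem_filter, Finset.mem_sigma, mem_stripsAbove, mem_stripsBelow,
      mem_partitionsOf, Finset.HasAntidiagonal.mem_antidiagonal] at h ⊢
    obtain ⟨⟨⟨h₁, c, h₂⟩, ⟨h₃, h₄⟩, h₅⟩, h₆, h₇⟩ := h
    have hd := degree_evenUp_add_degree_evenDown k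
    rw [← eq_evenDown h₆ h₅] at hd
    have hk := interlaces_evenUp h₆.antitone
    exact ⟨⟨⟨hk.antitone, by omega⟩, evenColumns_evenUp k⟩, hk⟩
  · rintro ⟨l, k⟩ h
    simp only [Finset.mem_filter, Finset.mem_sigma, mem_stripsBelow] at h
    simp only [Sigma.mk.injEq, heq_eq_eq, and_true]
    exact (eq_evenUp h.2 h.1.2).symm
  · rintro ⟨⟨⟨a, b⟩, l⟩, k⟩ h
    simp only [Finset.mem_filter, Finset.mem_sigma, mem_stripsAbove, mem_partitionsOf,
      Finset.HasAntidiagonal.mem_antidiagonal] at h ⊢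
    obtain ⟨⟨⟨h₁, c, h₂⟩, ⟨h₃, h₄⟩, h₅⟩, h₆, h₇⟩ := h
    have hd := degree_evenUp_add_degree_evenDown k
    rw [← eq_evenDown h₆ h₅] at hd ⊢
    simp only [Sigma.mk.injEq, heq_eq_eq, and_true, Prod.mk.injEq]
    omega
  · rintro ⟨l, k⟩ h
    simp

lemma one_sub_mul_completeSeries_succ (y : A) (n : ℕ) :
    (1 - PowerSeries.C (x n * y) * PowerSeries.X ^ 2) * completeSeries x y (n + 1) =
      completeSeries x y n := by
  ext m
  rw [sub_mul, one_mul, mul_assoc, map_sub, PowerSeries.coeff_C_mul, PowerSeries.coeff_X_pow_mul']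
  simp only [completeSeries, PowerSeries.coeff_mk]
  match m with
  | 0 => simp [completeHom]
  | 1 => simp
  | m + 2 =>
    have e : (m + 2) / 2 = m / 2 + 1 := by omega
    simp only [Nat.even_add, even_two, iff_true, le_add_iff_nonneg_left, zero_le, if_true,
      Nat.add_sub_cancel, e, completeHom]
    split_ifs <;> ring

lemma prod_one_sub_mul_completeSeries (y : A) (n : ℕ) :
    (∏ i ∈ Finset.range n, (1 - PowerSeries.C (x i * y) * PowerSeries.X ^ 2)) *
      completeSeries x y n = 1 := by
  induction n with
  | zero =>
    ext m
    simp only [Finset.range_zero, Finset.prod_empty, one_mul, completeSeries,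
      PowerSeries.coeff_mk, PowerSeries.coeff_one]
    match m with
    | 0 => simp [completeHom]
    | 1 => simp
    | m + 2 =>
      have e : (m + 2) / 2 = m / 2 + 1 := by omega
      simp [e, completeHom]
  | succ n ih => rw [Finset.prod_range_succ, mul_assoc, one_sub_mul_completeSeries_succ, ih]

/-- Littlewood's identity, with `q` marking the degree. -/
lemma prod_one_sub_mul_mk_evenSchurSum (n : ℕ) :
    (∏ j ∈ Finset.range n, ∏ i ∈ Finset.range j,
        (1 - PowerSeries.C (x i * x j) * PowerSeries.X ^ 2)) *
      PowerSeries.mk (evenSchurSum x n) = 1 := by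
  induction n with
  | zero =>
    ext m
    simp only [Finset.range_zero, Finset.prod_empty, one_mul, PowerSeries.coeff_mk,
      PowerSeries.coeff_one, evenSchurSum, branchSchur]
    rw [Finset.sum_ite_eq']
    simp only [Finset.mem_filter, mem_partitionsOf, map_zero]
    congr 1
    exact propext ⟨fun h => h.1.2.symm, fun h => ⟨⟨fun _ _ _ => le_rfl, h.symm⟩, fun _ => rfl⟩⟩
  | succ n ih =>
    rw [Finset.prod_range_succ, mk_evenSchurSum_succ, mul_mul_mul_comm, mul_left_comm,
      mul_right_comm, mul_comm, mul_assoc, mul_comm (completeSeries _ _ _),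
      prod_one_sub_mul_completeSeries, mul_one, ih]

lemma branchSchur_eq_zero {n : ℕ} {l : ℕ →₀ ℕ} (h : l n ≠ 0) : branchSchur x n l = 0 := by
  induction n generalizing l with
  | zero =>
    rw [branchSchur, if_neg]
    rintro rfl
    exact h rfl
  | succ n ih =>
    rw [branchSchur]
    refine Finset.sum_eq_zero fun m hm => ?_
    have := (mem_stripsBelow.1 hm n).2
    rw [ih (by omega), mul_zero]

end

section Tableaux

lemma mem_pcells {r : ℕ} {f : Fin r → ℕ} {p : Fin r × ℕ} : p ∈ pcells f ↔ p.2 < f p.1 := by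
  simp only [pcells, Finset.mem_filter, Finset.mem_product, Finset.mem_univ, Finset.mem_range,
    true_and, and_iff_right_iff_imp]
  exact fun h => h.trans_le (Finset.le_sup (f := f) (Finset.mem_univ p.1))

lemma card_pcells {r : ℕ} (f : Fin r → ℕ) : (pcells f).card = ∑ i, f i := by
  rw [pcells, Finset.card_filter, Finset.sum_product]
  refine Finset.sum_congr rfl fun i _ => ?_
  rw [← Finset.card_filter]
  convert Finset.card_range (f i) using 2
  ext j
  simp only [Finset.mem_filter, Finset.mem_range, and_iff_right_iff_imp]
  exact fun h => h.trans_le (Finset.le_sup (f := f) (Finset.mem_univ i))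

/-- Extension of a sequence of row lengths by zero. -/
def rows {r : ℕ} (f : Fin r → ℕ) : ℕ →₀ ℕ :=
  Finsupp.ofSupportFinite (fun i => if h : i < r then f ⟨i, h⟩ else 0) <| by
    refine (Finset.range r).finite_toSet.subset fun i hi => ?_
    by_contra hN
    exact hi (dif_neg (by simpa using hN))

lemma rows_coe {r : ℕ} (f : Fin r → ℕ) (i : Fin r) : rows f i = f i := dif_pos i.2

lemma rows_of_lt {r : ℕ} (f : Fin r → ℕ) {i : ℕ} (h : i < r) : rows f i = f ⟨i, h⟩ := dif_pos h

lemma rows_of_le {r : ℕ} (f : Fin r → ℕ) {i : ℕ} (h : r ≤ i) : rows f i = 0 :=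
  dif_neg (not_lt.2 h)

lemma rows_restrict {r : ℕ} {m : ℕ →₀ ℕ} (h : ∀ i, r ≤ i → m i = 0) :
    rows (fun i : Fin r => m i) = m := by
  ext i
  obtain hi | hi := lt_or_ge i r
  · exact rows_of_lt _ hi
  · rw [rows_of_le _ hi, h i hi]

lemma rows_injective {r : ℕ} : Function.Injective (rows (r := r)) := fun f g h => by
  ext i
  rw [← rows_coe f, h, rows_coe]

lemma degree_rows {r : ℕ} (f : Fin r → ℕ) : (rows f).degree = ∑ i, f i := by
  rw [degree_eq_sum_range _ fun i hi => rows_of_le f hi, Finset.sum_range]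
  simp_rw [rows_coe]

lemma antitone_rows {r : ℕ} {f : Fin r → ℕ} (hf : Antitone f) : Antitone (rows f) := by
  intro i j hij
  obtain hj | hj := lt_or_ge j r
  · rw [rows_of_lt f hj, rows_of_lt f (hij.trans_lt hj)]
    exact hf hij
  · simp [rows_of_le f hj]

lemma mem_iff_lt_card {s : Finset ℕ} (hs : ∀ j ∈ s, ∀ k ≤ j, k ∈ s) (j : ℕ) :
    j ∈ s ↔ j < s.card := by
  constructor
  · intro hj
    have : Finset.range (j + 1) ⊆ s := fun k hk =>
      hs j hj k (Nat.lt_succ_iff.1 (Finset.mem_range.1 hk))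
    simpa using Finset.card_le_card this
  · intro hj
    by_contra h
    have : s ⊆ Finset.range j := fun k hk => by
      rw [Finset.mem_range]
      by_contra hkj
      exact h (hs k hk j (not_lt.1 hkj))
    have := Finset.card_le_card this
    rw [Finset.card_range] at this
    omega

variable {r n : ℕ} {f g : Fin r → ℕ}

/-- The shape formed by the entries of `T` other than the largest possible one. -/
def innerShape (T : {c // c ∈ pcells f} → Fin (n + 1)) (i : Fin r) : ℕ :=
  ((Finset.range (f i)).filter
    (fun j => ∃ h : (i, j) ∈ pcells f, T ⟨(i, j), h⟩ ≠ Fin.last n)).card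

lemma mem_pcells_innerShape {T : {c // c ∈ pcells f} → Fin (n + 1)} (hT : IsSSYT f T)
    (c : {c // c ∈ pcells f}) : c.1 ∈ pcells (innerShape T) ↔ T c ≠ Fin.last n := by
  obtain ⟨⟨i, j⟩, hc⟩ := c
  rw [mem_pcells, innerShape, ← mem_iff_lt_card]
  · simp only [Finset.mem_filter, Finset.mem_range]
    exact ⟨fun h => h.2.2, fun h => ⟨mem_pcells.1 hc, hc, h⟩⟩
  · intro j hj k hk
    simp only [Finset.mem_filter, Finset.mem_range] at hj ⊢
    obtain ⟨h₁, h₂, h₃⟩ := hj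
    have h₄ : (i, k) ∈ pcells f := mem_pcells.2 (hk.trans_lt h₁)
    refine ⟨hk.trans_lt h₁, h₄, fun h => h₃ (Fin.last_le_iff.1 ?_)⟩
    rw [← h]
    exact hT.1 ⟨(i, k), h₄⟩ ⟨(i, j), h₂⟩ rfl hk

lemma innerShape_le (T : {c // c ∈ pcells f} → Fin (n + 1)) (i : Fin r) :
    innerShape T i ≤ f i :=
  (Finset.card_filter_le _ _).trans_eq (Finset.card_range _)

lemma interlaces_rows_innerShape (hf : Antitone f) {T : {c // c ∈ pcells f} → Fin (n + 1)}
    (hT : IsSSYT f T) : Interlaces (rows f) (rows (innerShape T)) := by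
  intro i
  obtain hi | hi := lt_or_ge i r
  · rw [rows_of_lt f hi, rows_of_lt _ hi]
    refine ⟨innerShape_le T _, ?_⟩
    obtain hi' | hi' := lt_or_ge (i + 1) r
    · rw [rows_of_lt f hi']
      by_contra! h
      have h₁ : ((⟨i + 1, hi'⟩ : Fin r), innerShape T ⟨i, hi⟩) ∈ pcells f := mem_pcells.2 h
      have hle : (⟨i, hi⟩ : Fin r) ≤ ⟨i + 1, hi'⟩ := Nat.le_succ i
      have h₂ : ((⟨i, hi⟩ : Fin r), innerShape T ⟨i, hi⟩) ∈ pcells f :=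
        mem_pcells.2 (h.trans_le (hf hle))
      have h₃ := hT.2 ⟨_, h₂⟩ ⟨_, h₁⟩ rfl (Nat.lt_succ_self i)
      have h₄ := (mem_pcells_innerShape hT ⟨_, h₂⟩).2 (h₃.trans_le (Fin.le_last _)).ne
      exact lt_irrefl _ (mem_pcells.1 h₄)
    · simp [rows_of_le f hi']
  · rw [rows_of_le f hi, rows_of_le _ hi, rows_of_le f (hi.trans (Nat.le_succ i))]
    simp

/-- Restriction of a filling to a smaller shape on which the largest entry does not occur. -/
def restrictFilling (hgf : pcells g ⊆ pcells f) (T : {c // c ∈ pcells f} → Fin (n + 1))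
    (hT : ∀ c : {c // c ∈ pcells g}, T ⟨c.1, hgf c.2⟩ ≠ Fin.last n) :
    {c // c ∈ pcells g} → Fin n :=
  fun c => (T ⟨c.1, hgf c.2⟩).castPred (hT c)

variable (f) in
/-- Extension of a filling to a larger shape by the largest possible entry. -/
def extendFilling (T : {c // c ∈ pcells g} → Fin n) (c : {c // c ∈ pcells f}) : Fin (n + 1) :=
  if h : c.1 ∈ pcells g then (T ⟨c.1, h⟩).castSucc else Fin.last n

lemma extendFilling_of_mem (T : {c // c ∈ pcells g} → Fin n) {c : {c // c ∈ pcells f}}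
    (h : c.1 ∈ pcells g) : extendFilling f T c = (T ⟨c.1, h⟩).castSucc := dif_pos h

lemma extendFilling_of_not_mem (T : {c // c ∈ pcells g} → Fin n) {c : {c // c ∈ pcells f}}
    (h : c.1 ∉ pcells g) : extendFilling f T c = Fin.last n := dif_neg h

lemma extendFilling_ne_last_iff (T : {c // c ∈ pcells g} → Fin n) (c : {c // c ∈ pcells f}) :
    extendFilling f T c ≠ Fin.last n ↔ c.1 ∈ pcells g := by
  by_cases h : c.1 ∈ pcells g
  · simp [extendFilling_of_mem T h, h, Fin.castSucc_ne_last]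
  · simp [extendFilling_of_not_mem T h, h]

lemma isSSYT_restrictFilling (hgf : pcells g ⊆ pcells f)
    {T : {c // c ∈ pcells f} → Fin (n + 1)} (h : IsSSYT f T)
    (hT : ∀ c : {c // c ∈ pcells g}, T ⟨c.1, hgf c.2⟩ ≠ Fin.last n) :
    IsSSYT g (restrictFilling hgf T hT) :=
  ⟨fun p q h₁ h₂ => Fin.castPred_le_castPred_iff.2 (h.1 ⟨p.1, hgf p.2⟩ ⟨q.1, hgf q.2⟩ h₁ h₂),
    fun p q h₁ h₂ => Fin.castPred_lt_castPred_iff.2 (h.2 ⟨p.1, hgf p.2⟩ ⟨q.1, hgf q.2⟩ h₁ h₂)⟩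

lemma isSSYT_extendFilling (h : Interlaces (rows f) (rows g)) {T : {c // c ∈ pcells g} → Fin n}
    (hT : IsSSYT g T) : IsSSYT f (extendFilling f T) := by
  refine ⟨fun p q h₁ h₂ => ?_, fun p q h₁ h₂ => ?_⟩
  · by_cases hq : q.1 ∈ pcells g
    · have hp : p.1 ∈ pcells g := by
        rw [mem_pcells] at hq ⊢
        rw [h₁]
        omega
      rw [extendFilling_of_mem T hp, extendFilling_of_mem T hq, Fin.castSucc_le_castSucc_iff]
      exact hT.1 _ _ h₁ h₂
    · rw [extendFilling_of_not_mem T hq]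
      exact Fin.le_last _
  · have hp : p.1 ∈ pcells g := by
      have hq := mem_pcells.1 q.2
      have h₃ := (h p.1.1).2
      have h₄ : rows f q.1.1 ≤ rows f (p.1.1 + 1) := h.antitone h₂
      rw [rows_coe] at h₃ h₄
      rw [mem_pcells]
      omega
    by_cases hq : q.1 ∈ pcells g
    · rw [extendFilling_of_mem T hp, extendFilling_of_mem T hq, Fin.castSucc_lt_castSucc_iff]
      exact hT.2 _ _ h₁ h₂
    · rw [extendFilling_of_mem T hp, extendFilling_of_not_mem T hq]
      exact Fin.castSucc_lt_last _

lemma pcells_subset (h : Interlaces (rows f) (rows g)) : pcells g ⊆ pcells f := fun c hc => by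
  have := (h c.1).1
  rw [rows_coe, rows_coe] at this
  rw [mem_pcells] at hc ⊢
  omega

lemma innerShape_extendFilling (h : Interlaces (rows f) (rows g))
    (T : {c // c ∈ pcells g} → Fin n) : innerShape (extendFilling f T) = g := by
  ext i
  rw [innerShape]
  convert Finset.card_range (g i) using 2
  ext j
  simp only [extendFilling_ne_last_iff, Finset.mem_filter, Finset.mem_range]
  refine ⟨fun h => mem_pcells.1 h.2.2, fun hj => ?_⟩
  have hg : (i, j) ∈ pcells g := mem_pcells.2 hj
  exact ⟨mem_pcells.1 (pcells_subset h hg), pcells_subset h hg, hg⟩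

variable {A : Type*} [CommRing A] (x : ℕ → A)

/-- The generating function of semistandard tableaux of shape `f`, an entry `i` having
weight `x i`. -/
def schurEval (f : Fin r → ℕ) (n : ℕ) : A :=
  ∑ T ∈ Finset.univ.filter (fun T : {c // c ∈ pcells f} → Fin n => IsSSYT f T),
    ∏ c : {c // c ∈ pcells f}, x (T c)

lemma prod_extendFilling (h : Interlaces (rows f) (rows g)) (T : {c // c ∈ pcells g} → Fin n) :
    ∏ c : {c // c ∈ pcells f}, x (extendFilling f T c) =
      x n ^ ((rows f).degree - (rows g).degree) * ∏ c : {c // c ∈ pcells g}, x (T c) := by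
  set w : Fin r × ℕ → A := fun c => if h : c ∈ pcells g then x (T ⟨c, h⟩) else x n with hw
  have h₁ : ∀ c : {c // c ∈ pcells f}, x (extendFilling f T c) = w c.1 := fun c => by
    by_cases hc : c.1 ∈ pcells g
    · simp [extendFilling_of_mem T hc, hw, hc]
    · simp [extendFilling_of_not_mem T hc, hw, hc]
  have h₂ : ∀ c : {c // c ∈ pcells g}, x (T c) = w c.1 := fun c => by
    simp [hw, c.2]
  simp_rw [h₁, h₂]
  rw [Finset.prod_coe_sort (pcells f) w, Finset.prod_coe_sort (pcells g) w,
    ← Finset.prod_sdiff (pcells_subset h), degree_rows, degree_rows, ← card_pcells,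
    ← card_pcells, ← Finset.card_sdiff_of_subset (pcells_subset h), ← Finset.prod_const]
  congr 1
  refine Finset.prod_congr rfl fun c hc => ?_
  simp [hw, (Finset.mem_sdiff.1 hc).2]

lemma sum_isSSYT_innerShape_eq (h : Interlaces (rows f) (rows g)) :
    ∑ T ∈ (Finset.univ.filter
        (fun T : {c // c ∈ pcells f} → Fin (n + 1) => IsSSYT f T)).filter
        (fun T => rows (innerShape T) = rows g),
      ∏ c : {c // c ∈ pcells f}, x (T c) =
    x n ^ ((rows f).degree - (rows g).degree) * schurEval x g n := by
  rw [schurEval, Finset.mul_sum]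
  have hgf := pcells_subset h
  have key : ∀ T ∈ (Finset.univ.filter
      (fun T : {c // c ∈ pcells f} → Fin (n + 1) => IsSSYT f T)).filter
      (fun T => rows (innerShape T) = rows g), IsSSYT f T ∧
        ∀ c : {c // c ∈ pcells f}, c.1 ∈ pcells g ↔ T c ≠ Fin.last n := fun T hT => by
    simp only [Finset.mem_filter, Finset.mem_univ, true_and] at hT
    refine ⟨hT.1, fun c => ?_⟩
    rw [← rows_injective hT.2, mem_pcells_innerShape hT.1]
  refine Finset.sum_bij'
    (fun T hT => restrictFilling hgf T fun c => ((key T hT).2 ⟨c.1, hgf c.2⟩).1 c.2)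
    (fun T _ => extendFilling f T) ?_ ?_ ?_ ?_ ?_
  · intro T hT
    simp only [Finset.mem_filter, Finset.mem_univ, true_and]
    exact isSSYT_restrictFilling hgf (key T hT).1 _
  · intro T hT
    simp only [Finset.mem_filter, Finset.mem_univ, true_and] at hT ⊢
    exact ⟨isSSYT_extendFilling h hT, by rw [innerShape_extendFilling h]⟩
  · intro T hT
    ext1 c
    by_cases hc : c.1 ∈ pcells g
    · rw [extendFilling_of_mem _ hc, restrictFilling, Fin.castSucc_castPred]
    · rw [extendFilling_of_not_mem _ hc]
      by_contra hne
      exact hc (((key T hT).2 c).2 (Ne.symm hne))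
  · intro T hT
    ext1 c
    simp only [restrictFilling]
    simp only [extendFilling_of_mem T (c := ⟨c.1, hgf c.2⟩) c.2, Fin.castPred_castSucc]
  · intro T hT
    rw [← prod_extendFilling x h]
    refine Finset.prod_congr rfl fun c _ => ?_
    by_cases hc : c.1 ∈ pcells g
    · rw [extendFilling_of_mem _ hc, restrictFilling, Fin.castSucc_castPred]
    · rw [extendFilling_of_not_mem _ hc]
      by_contra hne
      exact hc (((key T hT).2 c).2 fun h => hne (by rw [h]))

lemma schurEval_zero (f : Fin r → ℕ) : schurEval x f 0 = if rows f = 0 then 1 else 0 := by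
  split_ifs with h
  · have : IsEmpty {c // c ∈ pcells f} := ⟨fun c => by
      have := mem_pcells.1 c.2
      rw [← rows_coe f, h] at this
      simp at this⟩
    rw [schurEval, Finset.filter_true_of_mem fun T _ =>
      ⟨fun p => isEmptyElim p, fun p => isEmptyElim p⟩]
    simp
  · obtain ⟨i, hi⟩ : ∃ i, rows f i ≠ 0 := by
      by_contra! h'
      exact h (Finsupp.ext h')
    have hir : i < r := by
      by_contra hr
      exact hi (rows_of_le f (not_lt.1 hr))
    rw [rows_of_lt f hir] at hi
    have hc : ((⟨i, hir⟩ : Fin r), 0) ∈ pcells f := mem_pcells.2 (Nat.pos_of_ne_zero hi)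
    refine Finset.sum_eq_zero fun T _ => (T ⟨_, hc⟩).elim0

lemma schurEval_eq_branchSchur (n : ℕ) {f : Fin r → ℕ} (hf : Antitone f) :
    schurEval x f n = branchSchur x n (rows f) := by
  induction n generalizing f with
  | zero => rw [schurEval_zero, branchSchur]
  | succ n ih =>
    rw [schurEval, branchSchur, ← Finset.sum_fiberwise_of_maps_to
      (g := fun T => rows (innerShape T)) (t := stripsBelow (rows f)) fun T hT =>
        mem_stripsBelow.2 (interlaces_rows_innerShape hf (Finset.mem_filter.1 hT).2)]
    refine Finset.sum_congr rfl fun m hm => ?_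
    have hm := mem_stripsBelow.1 hm
    obtain ⟨g, rfl⟩ : ∃ g : Fin r → ℕ, m = rows g :=
      ⟨_, (rows_restrict fun i hi => by
        have := (hm i).1
        rw [rows_of_le f hi] at this
        omega).symm⟩
    have hg : Antitone g := fun i j hij => by
      rw [← rows_coe g, ← rows_coe g]
      exact hm.antitone_right hij
    rw [sum_isSSYT_innerShape_eq x hm, ih hg]

lemma isHomogeneous_schurPoly (f : Fin r → ℕ) (n : ℕ) :
    (schurPoly f n).IsHomogeneous (∑ i, f i) := by
  refine MvPolynomial.IsHomogeneous.sum _ _ _ fun T _ => ?_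
  convert MvPolynomial.IsHomogeneous.prod Finset.univ
    (fun c : {c // c ∈ pcells f} => (MvPolynomial.X (T c) : MvPolynomial (Fin n) ℤ))
    (fun _ => 1) fun c _ => MvPolynomial.isHomogeneous_X _ _
  simp [card_pcells]

/-- The variables of `MvPolynomial (Fin n) ℤ`, extended by zero to a sequence. -/
def polyVar (n i : ℕ) : MvPolynomial (Fin n) ℤ :=
  if h : i < n then MvPolynomial.X ⟨i, h⟩ else 0

lemma polyVar_coe (i : Fin n) : polyVar n i = MvPolynomial.X i := dif_pos i.2

lemma schurPoly_eq_branchSchur (n : ℕ) {f : Fin r → ℕ} (hf : Antitone f) :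
    schurPoly f n = branchSchur (polyVar n) n (rows f) := by
  rw [← schurEval_eq_branchSchur _ _ hf, schurPoly, schurEval]
  simp_rw [polyVar_coe]

lemma forall_even_conjPart_iff {f : Fin r → ℕ} (hf : Antitone f) :
    (∀ j, Even (conjPart f j)) ↔ EvenColumns (rows f) := by
  have hr := antitone_rows hf
  have key : ∀ i j, j < rows f i ↔ i < conjPart f j := by
    intro i j
    have hc : conjPart f j = ((Finset.range r).filter (fun i => j < rows f i)).card := by
      rw [conjPart, Finset.card_filter, Finset.card_filter, Finset.sum_range]
      simp_rw [rows_coe]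
    rw [hc, ← mem_iff_lt_card]
    · simp only [Finset.mem_filter, Finset.mem_range, iff_and_self]
      intro h
      by_contra hi
      rw [rows_of_le f (not_lt.1 hi)] at h
      omega
    · intro a ha b hb
      simp only [Finset.mem_filter, Finset.mem_range] at ha ⊢
      exact ⟨by omega, ha.2.trans_le (hr hb)⟩
  constructor
  · intro h i
    refine le_antisymm ?_ (hr (Nat.le_succ _))
    by_contra! hlt
    have h₁ := (key _ _).1 hlt
    have h₂ := (key (2 * i + 1) (rows f (2 * i + 1))).not.1 (lt_irrefl _)
    obtain ⟨c, hc⟩ := h (rows f (2 * i + 1))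
    omega
  · intro h j
    by_contra hodd
    obtain ⟨c, hc⟩ := Nat.not_even_iff_odd.1 hodd
    have h₁ := (key (2 * c) j).2 (by omega)
    rw [h c, key] at h₁
    omega

end Tableaux

section Transfer

variable {n : ℕ}

/-- Specialization at `q = 1` of the part of a power series in `q` in which the coefficient of
`q ^ m` has degree `m`. -/
def diagonalSeries (G : PowerSeries (MvPolynomial (Fin n) ℤ)) : MvPowerSeries (Fin n) ℤ :=
  fun d => MvPolynomial.coeff d (PowerSeries.coeff d.degree G)

lemma coeff_diagonalSeries (G : PowerSeries (MvPolynomial (Fin n) ℤ)) (d : Fin n →₀ ℕ) :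
    MvPowerSeries.coeff d (diagonalSeries G) =
      MvPolynomial.coeff d (PowerSeries.coeff d.degree G) := rfl

lemma diagonalSeries_one : diagonalSeries (n := n) 1 = 1 := by
  ext d
  rw [coeff_diagonalSeries, PowerSeries.coeff_one, MvPowerSeries.coeff_one]
  simp only [Finsupp.degree_eq_zero_iff]
  split_ifs with h
  · simp [h]
  · simp

lemma diagonalSeries_one_sub_mul (i j : Fin n) (G : PowerSeries (MvPolynomial (Fin n) ℤ)) :
    diagonalSeries ((1 - PowerSeries.C (MvPolynomial.X i * MvPolynomial.X j) *
        PowerSeries.X ^ 2) * G) =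
      (1 - MvPowerSeries.X i * MvPowerSeries.X j) * diagonalSeries G := by
  ext d
  have h₁ : (MvPolynomial.X i * MvPolynomial.X j : MvPolynomial (Fin n) ℤ) =
      MvPolynomial.monomial (Finsupp.single i 1 + Finsupp.single j 1) 1 := by
    rw [MvPolynomial.X, MvPolynomial.X, MvPolynomial.monomial_mul, one_mul]
  have h₂ : (MvPowerSeries.X i * MvPowerSeries.X j : MvPowerSeries (Fin n) ℤ) =
      MvPowerSeries.monomial (Finsupp.single i 1 + Finsupp.single j 1) 1 := by
    rw [MvPowerSeries.X, MvPowerSeries.X, MvPowerSeries.monomial_mul_monomial, one_mul]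
  rw [h₁, h₂, sub_mul, sub_mul, one_mul, one_mul, map_sub, coeff_diagonalSeries, map_sub,
    MvPolynomial.coeff_sub, coeff_diagonalSeries, mul_assoc, PowerSeries.coeff_C_mul,
    PowerSeries.coeff_X_pow_mul', MvPowerSeries.coeff_monomial_mul]
  congr 1
  rw [MvPolynomial.coeff_monomial_mul']
  split_ifs with h₃ h₄
  · obtain ⟨e, rfl⟩ := exists_add_of_le h₃
    have h₅ : (Finsupp.single i 1 + Finsupp.single j 1 + e).degree - 2 = e.degree := by
      simp only [map_add, Finsupp.degree_single]
      omega
    rw [coeff_diagonalSeries, add_tsub_cancel_left, h₅]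
  · have := Finsupp.degree_mono h₃
    simp only [map_add, Finsupp.degree_single] at this
    omega
  · rfl

lemma diagonalSeries_prod_mul (s : Finset (Fin n × Fin n))
    (G : PowerSeries (MvPolynomial (Fin n) ℤ)) :
    diagonalSeries ((∏ p ∈ s, (1 - PowerSeries.C (MvPolynomial.X p.1 * MvPolynomial.X p.2) *
        PowerSeries.X ^ 2)) * G) =
      (∏ p ∈ s, (1 - MvPowerSeries.X p.1 * MvPowerSeries.X p.2)) * diagonalSeries G := by
  induction s using Finset.induction_on with
  | empty => simp
  | insert p s hp ih =>
    rw [Finset.prod_insert hp, Finset.prod_insert hp, mul_assoc, diagonalSeries_one_sub_mul, ih,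
      mul_assoc]

lemma prod_range_prod_range_eq {M : Type*} [CommMonoid M] (w : ℕ → ℕ → M) (n : ℕ) :
    ∏ j ∈ Finset.range n, ∏ i ∈ Finset.range j, w i j =
      ∏ p ∈ Finset.univ.filter (fun p : Fin n × Fin n => p.1 < p.2), w p.1 p.2 := by
  rw [Finset.prod_filter, Fintype.prod_prod_type_right, Finset.prod_range]
  refine Finset.prod_congr rfl fun j _ => ?_
  rw [← Finset.prod_filter]
  symm
  refine Finset.prod_bij (fun i _ => (i : ℕ)) (fun i hi => ?_) (fun _ _ _ _ h => ?_)
    (fun i hi => ?_) fun _ _ => rfl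
  · simpa using hi
  · exact Fin.ext h
  · have hi := Finset.mem_range.1 hi
    exact ⟨⟨i, hi.trans j.2⟩, Finset.mem_filter.2 ⟨Finset.mem_univ _, hi⟩, rfl⟩

lemma sum_coeff_schurPoly_eq (d : Fin n →₀ ℕ) :
    ∑ κ ∈ (partitionsLE n (∑ i, d i)).filter (fun f => ∀ j : ℕ, Even (conjPart f j)),
        MvPolynomial.coeff d (schurPoly κ n) =
      MvPolynomial.coeff d (evenSchurSum (polyVar n) n d.degree) := by
  rw [evenSchurSum, MvPolynomial.coeff_sum, ← Finsupp.degree_eq_sum]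
  have hanti : ∀ κ ∈ (partitionsLE n d.degree).filter (fun f => ∀ j : ℕ, Even (conjPart f j)),
      Antitone κ := fun κ hκ => by
    simp only [partitionsLE, Finset.mem_filter] at hκ
    exact fun i j => hκ.1.2.1 i j
  refine Finset.sum_bij_ne_zero (fun κ _ _ => rows κ) (fun κ hκ h₀ => ?_)
    (fun _ _ _ _ _ _ h => rows_injective h) (fun l hl h₀ => ?_) fun κ hκ h₀ => ?_
  · have hd : d.degree = ∑ i, κ i := by
      rw [Finsupp.degree_eq_weight_one]
      exact isHomogeneous_schurPoly κ n h₀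
    rw [Finset.mem_filter, mem_partitionsOf, degree_rows,
      ← forall_even_conjPart_iff (hanti κ hκ)]
    exact ⟨⟨antitone_rows (hanti κ hκ), hd.symm⟩, (Finset.mem_filter.1 hκ).2⟩
  · rw [Finset.mem_filter, mem_partitionsOf] at hl
    have hl₀ : l n = 0 := by
      by_contra h
      exact h₀ (by rw [branchSchur_eq_zero _ h, MvPolynomial.coeff_zero])
    have hrows := rows_restrict (r := n) (m := l) fun i hi =>
      Nat.le_zero.1 ((hl.1.1 hi).trans hl₀.le)
    have hκ : Antitone fun i : Fin n => l i := fun i j hij => hl.1.1 hij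
    have hsum : ∑ i : Fin n, l i = d.degree := by
      rw [← hl.1.2, ← degree_rows (fun i : Fin n => l i), hrows]
    refine ⟨fun i => l i, ?_, ?_, hrows⟩
    · rw [Finset.mem_filter, forall_even_conjPart_iff hκ, hrows]
      refine ⟨?_, hl.2⟩
      simp only [partitionsLE, Finset.mem_filter, Fintype.mem_piFinset, Finset.mem_range]
      refine ⟨fun i => ?_, fun i j hij => hκ hij, hsum.le⟩
      have := Finset.single_le_sum (f := fun i : Fin n => l i) (fun _ _ => Nat.zero_le _)
        (Finset.mem_univ i)
      omega
    · rwa [schurPoly_eq_branchSchur n hκ, hrows]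
  · rw [schurPoly_eq_branchSchur n (hanti κ hκ)]

end Transfer

/-- Littlewood's identity for partitions with even conjugate:
`Σ_{λ : λ' even} s_λ(α_1,…,α_n) = ∏_{1 ≤ i < j ≤ n} 1/(1 - α_i α_j)`,
stated as: the formal power series whose coefficients are those of the sum of the Schur
polynomials `s_λ(α_1,…,α_n)` over all partitions `λ` with at most `n` parts whose
conjugate `λ'` has all parts even, is the inverse of `∏_{i<j} (1 - α_i α_j)`. -/
theorem littlewood_conjugate_even (n : ℕ) :
    (∏ p ∈ Finset.univ.filter (fun p : Fin n × Fin n => p.1 < p.2),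
        (1 - MvPowerSeries.X p.1 * MvPowerSeries.X p.2 : MvPowerSeries (Fin n) ℤ)) *
      (show MvPowerSeries (Fin n) ℤ from
        fun d => ∑ κ ∈ (partitionsLE n (∑ i, d i)).filter
            (fun f => ∀ j : ℕ, Even (conjPart f j)),
          MvPolynomial.coeff d (schurPoly κ n)) = 1 := by
  have h := congrArg diagonalSeries (prod_one_sub_mul_mk_evenSchurSum (polyVar n) n)
  rw [prod_range_prod_range_eq (fun i j => 1 - PowerSeries.C (polyVar n i * polyVar n j) *
    PowerSeries.X ^ 2)] at h
  simp_rw [polyVar_coe] at h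
  rw [diagonalSeries_prod_mul, diagonalSeries_one] at h
  refine Eq.trans ?_ h
  congr 1
  ext d
  rw [coeff_diagonalSeries, PowerSeries.coeff_mk]
  exact sum_coeff_schurPoly_eq d

end
end

section
/- MacMahon's box formula: the number of plane partitions fitting inside the box B(a,b,c) = {(i,j,k) : 1 ≤ i ≤ a, 1 ≤ j ≤ b, 1 ≤ k ≤ c} equals ∏_{i=1}^a ∏_{j=1}^b ∏_{k=1}^c (i+j+k-1)/(i+j+k-2). -/
/-- Arrays of natural numbers on the triangle `u + v ≤ n`, weakly increasing in `u` and weakly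
decreasing in `v`, whose antidiagonal `u + v = n` is prescribed by `l` (and which are extended by
zero outside of the triangle). These are Gelfand–Tsetlin patterns with top row `l`. -/
def triangleArrays (n : ℕ) (l : Fin (n + 1) → ℕ) : Set (ℕ → ℕ → ℕ) :=
  {g | (∀ u v, u + v < n → g u v ≤ g (u + 1) v ∧ g u (v + 1) ≤ g u v) ∧
    (∀ u v (h : u + v = n), g u v = l ⟨u, by omega⟩) ∧ ∀ u v, n < u + v → g u v = 0}

namespace triangleArrays

theorem le_of_le_left {n : ℕ} {l : Fin (n + 1) → ℕ} {g : ℕ → ℕ → ℕ} (hg : g ∈ triangleArrays n l)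
    {u u' v : ℕ} (h : u ≤ u') (hn : u' + v ≤ n) : g u v ≤ g u' v := by
  induction u', h using Nat.le_induction with
  | base => rfl
  | succ k hk ih => exact (ih (by omega)).trans (hg.1 k v (by omega)).1

theorem le_of_le_right {n : ℕ} {l : Fin (n + 1) → ℕ} {g : ℕ → ℕ → ℕ} (hg : g ∈ triangleArrays n l)
    {u v v' : ℕ} (h : v ≤ v') (hn : u + v' ≤ n) : g u v' ≤ g u v := by
  induction v', h using Nat.le_induction with
  | base => rfl
  | succ k hk ih => exact (hg.1 u k (by omega)).2.trans (ih (by omega))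

/-- The rows that interlace with `l`. -/
def interlacing {n : ℕ} (l : Fin (n + 2) → ℕ) : Finset (Fin (n + 1) → ℕ) :=
  Fintype.piFinset fun u => Finset.Icc (l u.castSucc) (l u.succ)

/-- Prescribe the antidiagonal `u + v = n + 1` of an array. -/
def extend {n : ℕ} (l : Fin (n + 2) → ℕ) (g : ℕ → ℕ → ℕ) (u v : ℕ) : ℕ :=
  if h : u + v = n + 1 then l ⟨u, by omega⟩ else g u v

theorem extend_mem {n : ℕ} {l : Fin (n + 2) → ℕ} {m : Fin (n + 1) → ℕ} (hm : m ∈ interlacing l)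
    {g : ℕ → ℕ → ℕ} (hg : g ∈ triangleArrays n m) : extend l g ∈ triangleArrays (n + 1) l := by
  simp only [interlacing, Fintype.mem_piFinset, Finset.mem_Icc] at hm
  refine ⟨fun u v h => ?_, fun u v h => ?_, fun u v h => ?_⟩
  · obtain h | h := Nat.lt_succ_iff_lt_or_eq.1 h
    · have h1 := hg.1 u v h
      simp only [extend]
      rw [dif_neg (by omega), dif_neg (by omega), dif_neg (by omega)]
      exact h1
    · have h1 := hg.2.1 u v h
      have h2 := hm ⟨u, by omega⟩
      simp only [extend]
      rw [dif_neg (by omega), dif_pos (by omega), dif_pos (by omega), h1]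
      exact ⟨h2.2, h2.1⟩
  · simp [extend, h]
  · simp only [extend]
    rw [dif_neg (by omega)]
    exact hg.2.2 u v (by omega)

theorem extend_bijective {n : ℕ} (l : Fin (n + 2) → ℕ) :
    Function.Bijective (fun p : (Σ m : interlacing l, triangleArrays n m) =>
      (⟨extend l p.2, extend_mem p.1.2 p.2.2⟩ : triangleArrays (n + 1) l)) := by
  constructor
  · rintro ⟨⟨m, hm⟩, g, hg⟩ ⟨⟨m', hm'⟩, g', hg'⟩ h
    simp only [Subtype.mk.injEq] at h hg hg'
    have hgg : g = g' := by
      funext u v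
      obtain huv | huv := le_or_gt (u + v) n
      · have := congrFun (congrFun h u) v
        simp only [extend] at this
        rwa [dif_neg (by omega), dif_neg (by omega)] at this
      · rw [hg.2.2 u v huv, hg'.2.2 u v huv]
    subst hgg
    have hmm : m = m' := by
      funext u
      have hu : (u : ℕ) + (n - u) = n := by omega
      exact (hg.2.1 u _ hu).symm.trans (hg'.2.1 u _ hu)
    subst hmm
    rfl
  · rintro ⟨g, hg⟩
    refine ⟨⟨⟨fun u => g u (n - u), ?_⟩, fun u v => if u + v ≤ n then g u v else 0, ?_, ?_, ?_⟩, ?_⟩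
    · simp only [interlacing, Fintype.mem_piFinset, Finset.mem_Icc]
      intro u
      have h1 := hg.1 u (n - u) (by omega)
      rw [hg.2.1 (u + 1) (n - u) (by omega), hg.2.1 u (n - u + 1) (by omega)] at h1
      exact ⟨h1.2, h1.1⟩
    · intro u v h
      dsimp only
      rw [if_pos (by omega), if_pos (by omega), if_pos (by omega)]
      exact hg.1 u v (by omega)
    · intro u v h
      obtain rfl : v = n - u := by omega
      simp [h]
    · intro u v h
      exact if_neg (by omega)
    · simp only [Subtype.mk.injEq]
      funext u v
      simp only [extend]
      split_ifs with h1 h2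
      · exact (hg.2.1 u v h1).symm
      · rfl
      · exact (hg.2.2 u v (by omega)).symm

theorem finite_triangleArrays (n : ℕ) (l : Fin (n + 1) → ℕ) : Finite (triangleArrays n l) := by
  induction n with
  | zero =>
    refine Finite.of_injective (β := Unit) (fun _ => ()) fun g g' _ => Subtype.ext ?_
    funext u v
    obtain h | h := Nat.eq_zero_or_pos (u + v)
    · rw [g.2.2.1 u v h, g'.2.2.1 u v h]
    · rw [g.2.2.2 u v h, g'.2.2.2 u v h]
  | succ n ih => exact Finite.of_surjective _ (extend_bijective l).2

theorem card_zero (l : Fin 1 → ℕ) : Nat.card (triangleArrays 0 l) = 1 := by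
  refine Nat.card_eq_one_iff_exists.2
    ⟨⟨fun u v => if u + v = 0 then l 0 else 0, by simp, ?_, ?_⟩, fun g => Subtype.ext ?_⟩
  · intro u v h
    obtain rfl : u = 0 := by omega
    simp only [h, if_true]
    rfl
  · intro u v h
    exact if_neg (by omega)
  · funext u v
    dsimp only
    split_ifs with h
    · obtain rfl : u = 0 := by omega
      exact g.2.2.1 0 v h
    · exact g.2.2.2 u v (by omega)

theorem card_succ {n : ℕ} (l : Fin (n + 2) → ℕ) :
    Nat.card (triangleArrays (n + 1) l) = ∑ m ∈ interlacing l, Nat.card (triangleArrays n m) := by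
  have := fun m => finite_triangleArrays n m
  rw [← Nat.card_eq_of_bijective _ (extend_bijective l), Nat.card_sigma,
    Finset.sum_coe_sort (interlacing l) fun m => Nat.card (triangleArrays n m)]

end triangleArrays

open Matrix in
/-- Telescoping for determinants of binomial coefficients: the sum over interlacing arguments
gives the determinant of the next size. -/
theorem Matrix.sum_Ico_det_choose {n : ℕ} (x : Fin (n + 2) → ℕ) (hx : Monotone x) :
    ∑ y ∈ Fintype.piFinset fun i : Fin (n + 1) => Finset.Ico (x i.castSucc) (x i.succ),
      (of fun i j : Fin (n + 1) => ((y i).choose j : ℚ)).det =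
    (of fun i j : Fin (n + 2) => ((x i).choose j : ℚ)).det := by
  have h1 := (detRowAlternating (R := ℚ) (n := Fin (n + 1))).toMultilinearMap.map_sum_finset
    (fun _ (y : ℕ) (j : Fin (n + 1)) => (y.choose j : ℚ))
    (fun i => Finset.Ico (x i.castSucc) (x i.succ))
  refine (h1.symm.trans ?_)
  have h2 (p q k : ℕ) (h : p ≤ q) :
      ∑ y ∈ Finset.Ico p q, (y.choose k : ℚ) = (q.choose (k + 1) : ℚ) - p.choose (k + 1) := by
    induction q, h using Nat.le_induction with
    | base => simp
    | succ q hq ih =>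
      rw [Finset.sum_Ico_succ_top hq, ih, Nat.choose_succ_succ]
      push_cast
      ring
  let B : Matrix (Fin (n + 2)) (Fin (n + 2)) ℚ := of fun i j =>
    Fin.cases ((x 0).choose j : ℚ)
      (fun i => ((x i.succ).choose j : ℚ) - (x i.castSucc).choose j) i
  rw [det_eq_of_forall_row_eq_smul_add_pred (B := B) (fun _ => 1)
    (fun j => by simp [B]) (fun i j => by simp [B]), det_succ_column_zero, Fin.sum_univ_succ]
  simp only [B, of_apply, Fin.cases_zero, Fin.cases_succ, Fin.val_zero, Nat.choose_zero_right,
    Nat.cast_one, sub_self, mul_zero, zero_mul, Finset.sum_const_zero, pow_zero, mul_one, add_zero,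
    one_mul]
  change det _ = _
  congr 1
  ext i j
  rw [Finset.sum_apply, h2 _ _ _ (hx (Fin.castSucc_le_succ i))]
  simp

open Matrix in
theorem triangleArrays.card_eq_det (n : ℕ) (l : Fin (n + 1) → ℕ) (hl : Monotone l) :
    (Nat.card (triangleArrays n l) : ℚ) =
      (of fun i j : Fin (n + 1) => ((l i + i).choose j : ℚ)).det := by
  induction n with
  | zero =>
    rw [card_zero]
    simp
  | succ n ih =>
    rw [card_succ, ← sum_Ico_det_choose (fun i => l i + i) fun i j h => Nat.add_le_add (hl h) h]
    push_cast
    refine Finset.sum_bij (fun m _ i => m i + i) ?_ ?_ ?_ ?_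
    · intro m hm
      simp only [interlacing, Fintype.mem_piFinset, Finset.mem_Icc, Finset.mem_Ico,
        Fin.val_castSucc, Fin.val_succ] at hm ⊢
      intro i
      have := hm i
      omega
    · intro m _ m' _ h
      funext i
      exact Nat.add_right_cancel (congrFun h i)
    · intro y hy
      simp only [interlacing, Fintype.mem_piFinset, Finset.mem_Icc, Finset.mem_Ico,
        Fin.val_castSucc, Fin.val_succ] at hy ⊢
      refine ⟨fun i => y i - i, fun i => ?_, ?_⟩
      · have := hy i
        dsimp only
        omega
      · funext i
        have := hy i
        dsimp only
        omega
    · intro m hm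
      refine ih m fun i j hij => ?_
      simp only [interlacing, Fintype.mem_piFinset, Finset.mem_Icc] at hm
      obtain rfl | hij := hij.eq_or_lt
      · rfl
      · exact ((hm i).2.trans (hl (Fin.succ_le_castSucc_iff.2 hij))).trans (hm j).1

open Matrix in
theorem Matrix.det_vandermonde_natCast_eq {n : ℕ} (x : Fin (n + 1) → ℕ) :
    (vandermonde fun i => (x i : ℚ)).det =
      n.superFactorial * (of fun i j : Fin (n + 1) => ((x i).choose j : ℚ)).det := by
  rw [det_eval_matrixOfPolynomials_eq_det_vandermonde (fun i => (x i : ℚ))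
      (fun i => descPochhammer ℚ i) (fun i => descPochhammer_natDegree ℚ i)
      (fun i => monic_descPochhammer ℚ i), ← Nat.prod_range_succ_factorial,
    ← Fin.prod_univ_eq_prod_range (fun i => Nat.factorial i), Nat.cast_prod, ← det_mul_row]
  congr 1
  ext i j
  simp [descPochhammer_eval_eq_descFactorial, Nat.descFactorial_eq_factorial_mul_choose]

theorem Fin.prod_prod_Ioi_eq_prod_range {M : Type*} [CommMonoid M] (n : ℕ) (f : ℕ → ℕ → M) :
    ∏ i : Fin n, ∏ j ∈ Finset.Ioi i, f i j = ∏ j ∈ Finset.range n, ∏ i ∈ Finset.range j, f i j := by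
  rw [Finset.prod_comm' (t' := Finset.univ) (s' := fun j => Finset.Iio j) (by simp),
    ← Fin.prod_univ_eq_prod_range fun j => ∏ i ∈ Finset.range j, f i j]
  refine Finset.prod_congr rfl fun j _ => ?_
  have : Finset.range (j : ℕ) = (Finset.Iio j).map Fin.valEmbedding := by
    ext
    simp
  rw [this, Finset.prod_map]
  rfl

/-- The number of triangular arrays is given by Weyl's dimension formula. -/
theorem triangleArrays.card_eq_prod (n : ℕ) (l : ℕ → ℕ) (hl : Monotone l) :
    (Nat.card (triangleArrays n fun i => l i) : ℚ) =
      ∏ j ∈ Finset.range (n + 1), ∏ i ∈ Finset.range j,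
        (((l j + j : ℕ) : ℚ) - (l i + i : ℕ)) / ((j : ℚ) - i) := by
  have h0 : (n.superFactorial : ℚ) ≠ 0 := by
    rw [← Nat.prod_range_succ_factorial, Nat.cast_ne_zero, Finset.prod_ne_zero_iff]
    exact fun i _ => i.factorial_ne_zero
  have h1 := Matrix.det_vandermonde_natCast_eq fun i : Fin (n + 1) => l i + i
  rw [← card_eq_det n (fun i => l i) fun i j h => hl h] at h1
  rw [← mul_right_inj' h0, ← h1, ← Matrix.det_vandermonde_id_eq_superFactorial (R := ℚ)]
  simp only [Matrix.det_vandermonde]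
  rw [Fin.prod_prod_Ioi_eq_prod_range (n + 1) fun i j => ((j : ℚ) - i),
    Fin.prod_prod_Ioi_eq_prod_range (n + 1) fun i j => (((l j + j : ℕ) : ℚ) - (l i + i : ℕ))]
  simp only [← Finset.prod_mul_distrib]
  refine Finset.prod_congr rfl fun j _ => Finset.prod_congr rfl fun i hi => ?_
  rw [mul_div_cancel₀]
  have : (i : ℚ) < j := Nat.cast_lt.2 (Finset.mem_range.1 hi)
  exact sub_ne_zero.2 this.ne'

theorem prod_weyl_rectangle (a b c : ℕ) :
    ∏ j ∈ Finset.range (b + a), ∏ i ∈ Finset.range j,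
      ((((if j < b then 0 else c) + j : ℕ) : ℚ) - ((if i < b then 0 else c) + i : ℕ)) /
        ((j : ℚ) - i) =
    ∏ i ∈ Finset.range a, ∏ j ∈ Finset.range b, ((i : ℚ) + j + 1 + c) / ((i : ℚ) + j + 1) := by
  have hne {i j : ℕ} (h : i < j) : (j : ℚ) - i ≠ 0 := sub_ne_zero.2 (Nat.cast_lt.2 h).ne'
  rw [Finset.prod_range_add, Finset.prod_eq_one, one_mul]
  · refine Finset.prod_congr rfl fun k _ => ?_
    rw [Finset.prod_range_add, ← Finset.prod_range_reflect, Finset.prod_eq_one (s := .range k),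
      mul_one]
    · refine Finset.prod_congr rfl fun j hj => ?_
      rw [Finset.mem_range] at hj
      have hc : ((b - 1 - j : ℕ) : ℚ) = b - 1 - j := by
        rw [Nat.sub_sub, Nat.cast_sub (by omega)]
        push_cast
        ring
      rw [if_neg (by omega), if_pos (by omega)]
      push_cast
      rw [hc]
      congr 1 <;> ring
    · intro i hi
      rw [Finset.mem_range] at hi
      rw [if_neg (by omega), if_neg (by omega)]
      rw [Nat.cast_add, Nat.cast_add c, add_sub_add_left_eq_sub,
        div_self (hne (Nat.add_lt_add_left hi b))]
  · intro j hj
    refine Finset.prod_eq_one fun i hi => ?_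
    rw [Finset.mem_range] at hi hj
    rw [if_pos hj, if_pos (by omega), zero_add, zero_add, div_self (hne hi)]

theorem prod_range_telescope (x : ℚ) (hx : 0 < x) (c : ℕ) :
    ∏ k ∈ Finset.range c, (x + k + 1) / (x + k) = (x + c) / x := by
  induction c with
  | zero => simp [hx.ne']
  | succ c ih =>
    have : x + c ≠ 0 := by positivity
    rw [Finset.prod_range_succ, ih]
    push_cast
    field_simp
    ring

/-- The arrays of shape `a × (b + 1)` with entries at most `c`, weakly decreasing along rows and
columns, correspond to triangular arrays whose antidiagonal is `0, …, 0, c, …, c`. -/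
def planePartitionEquiv (a b c : ℕ) :
    {π : Fin a → Fin (b + 1) → ℕ //
      (∀ i i' j, i ≤ i' → π i' j ≤ π i j) ∧ (∀ i j j', j ≤ j' → π i j' ≤ π i j) ∧
        ∀ i j, π i j ≤ c} ≃
    triangleArrays (b + a) fun i => if (i : ℕ) < b + 1 then 0 else c where
  toFun π := ⟨fun u v => if b + a < u + v then 0 else if b < u then c else
      if h : v < a then π.1 ⟨v, h⟩ ⟨b - u, by omega⟩ else 0, by
    obtain ⟨π, h1, h2, h3⟩ := π
    refine ⟨fun u v h => ?_, fun u v h => ?_, fun u v h => if_pos h⟩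
    · dsimp only
      rw [if_neg (show ¬ b + a < u + v by omega), if_neg (show ¬ b + a < u + 1 + v by omega),
        if_neg (show ¬ b + a < u + (v + 1) by omega)]
      constructor
      · split_ifs <;> first | omega | exact h3 _ _ |
          exact h2 _ _ _ (Fin.mk_le_mk.2 (Nat.sub_le_sub_left (Nat.le_succ u) b))
      · split_ifs <;> first | omega | exact h1 _ _ _ (Fin.mk_le_mk.2 (Nat.le_succ v))
    · dsimp only
      split_ifs <;> omega⟩
  invFun g := ⟨fun i j => g.1 (b - j) i, by
    obtain ⟨g, hg⟩ := g
    refine ⟨fun i i' j h => ?_, fun i j j' h => ?_, fun i j => ?_⟩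
    · exact triangleArrays.le_of_le_right hg h (by omega)
    · exact triangleArrays.le_of_le_left hg (by have := Fin.le_def.1 h; omega) (by omega)
    · refine (triangleArrays.le_of_le_left hg (u' := b + a - i) (by omega) (by omega)).trans ?_
      rw [hg.2.1 (b + a - i) i (by omega)]
      dsimp only
      split_ifs <;> omega⟩
  left_inv π := by
    ext i j
    have h1 : ¬ b + a < b - (j : ℕ) + i := by omega
    have h2 : b - (b - (j : ℕ)) = j := by omega
    simp [h1, h2]
  right_inv g := by
    obtain ⟨g, hg⟩ := g
    ext u v
    dsimp only
    split_ifs with h1 h2 h3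
    · exact (hg.2.2 u v h1).symm
    · have h4 := triangleArrays.le_of_le_right hg (u := u) (v := v) (v' := b + a - u)
        (by omega) (by omega)
      have h5 := triangleArrays.le_of_le_left hg (u := u) (v := v) (u' := b + a - v)
        (by omega) (by omega)
      rw [hg.2.1 u (b + a - u) (by omega)] at h4
      rw [hg.2.1 (b + a - v) v (by omega)] at h5
      dsimp only at h4 h5
      split_ifs at h4 h5 <;> omega
    · have h4 : b - (b - u) = u := by omega
      simp [h4]
    · have h5 := triangleArrays.le_of_le_left hg (u := u) (v := v) (u' := b + a - v)
        (by omega) (by omega)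
      rw [hg.2.1 (b + a - v) v (by omega)] at h5
      dsimp only at h5
      split_ifs at h5 <;> omega


open scoped Classical

noncomputable section

/-- MacMahon's box formula: the number of plane partitions fitting inside the box
`B(a,b,c)` — i.e. `a × b` arrays of non-negative integers, weakly decreasing along rows
and columns, with all entries at most `c` — equals
`∏_{i=1}^a ∏_{j=1}^b ∏_{k=1}^c (i+j+k-1)/(i+j+k-2)`. -/
theorem macmahon_box_formula (a b c : ℕ) :
    (Nat.card {π : Fin a → Fin b → ℕ //
        (∀ i i' j, i ≤ i' → π i' j ≤ π i j) ∧
        (∀ i j j', j ≤ j' → π i j' ≤ π i j) ∧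
        ∀ i j, π i j ≤ c} : ℚ) =
    ∏ i ∈ Finset.range a, ∏ j ∈ Finset.range b, ∏ k ∈ Finset.range c,
      ((i : ℚ) + j + k + 2) / ((i : ℚ) + j + k + 1) := by
  cases b with
  | zero =>
    have : Nat.card {π : Fin a → Fin 0 → ℕ //
        (∀ i i' j, i ≤ i' → π i' j ≤ π i j) ∧ (∀ i j j', j ≤ j' → π i j' ≤ π i j) ∧
          ∀ i j, π i j ≤ c} = 1 :=
      Nat.card_eq_one_iff_exists.2
        ⟨⟨fun _ j => j.elim0, fun _ _ j => j.elim0, fun _ j => j.elim0, fun _ j => j.elim0⟩,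
          fun π => Subtype.ext (funext fun _ => funext fun j => j.elim0)⟩
    rw [this]
    simp
  | succ b =>
    rw [Nat.card_congr (planePartitionEquiv a b c),
      triangleArrays.card_eq_prod (b + a) (fun i => if i < b + 1 then 0 else c)
        fun i j h => by dsimp only; split_ifs <;> omega,
      add_right_comm b a 1, prod_weyl_rectangle]
    refine Finset.prod_congr rfl fun i _ => Finset.prod_congr rfl fun j _ => ?_
    rw [← prod_range_telescope _ (by positivity)]
    refine Finset.prod_congr rfl fun k _ => ?_
    congr 1 <;> ring

end
end

section
/- The q-analogue of MacMahon's formula: the generating function Σ_P q^{|P|}, summed over plane partitions P contained in the box B(a,b,c), equals ∏_{i=1}^a ∏_{j=1}^b ∏_{k=1}^c (1 - q^{i+j+k-1})/(1 - q^{i+j+k-2}). -/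
open scoped Classical

noncomputable section

open Finset Polynomial Matrix

/-- Subtracting from each row of a Vandermonde matrix its predecessor. -/
lemma det_vandermonde_eq_det_sub_pred {R : Type*} [CommRing R] {n : ℕ} (v : Fin (n + 1) → R) :
    (vandermonde v).det =
      (of fun i j : Fin n => v i.succ ^ (j + 1 : ℕ) - v i.castSucc ^ (j + 1 : ℕ)).det := by
  have h : (vandermonde v).det = (of fun (i j : Fin (n + 1)) =>
      Fin.cases (v 0 ^ (j : ℕ)) (fun i' : Fin n => v i'.succ ^ (j : ℕ) - v i'.castSucc ^ (j : ℕ))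
        i).det := by
    refine det_eq_of_forall_row_eq_smul_add_pred (fun _ => 1) (fun j => ?_) (fun i j => ?_)
    · simp [vandermonde_apply]
    · simp [vandermonde_apply]
  rw [h, det_succ_column_zero, Fin.sum_univ_succ]
  simp only [of_apply, Fin.cases_zero, Fin.cases_succ, Fin.val_zero, pow_zero, sub_self, mul_zero,
    zero_mul, Finset.sum_const_zero, add_zero, one_mul]
  congr 1

/-- Summing determinants over independent choices of their rows. -/
lemma sum_piFinset_det {R : Type*} [CommRing R] {n : ℕ} (s : Fin n → Finset ℕ)
    (f : Fin n → ℕ → Fin n → R) :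
    ∑ m ∈ Fintype.piFinset s, (of fun i j => f i (m i) j).det =
      (of fun i j => ∑ k ∈ s i, f i k j).det := by
  have h := (detRowAlternating (R := R) (n := Fin n)).toMultilinearMap.map_sum_finset
    (fun i k => f i k) s
  have e : (fun i => ∑ k ∈ s i, f i k) = (of fun i j => ∑ k ∈ s i, f i k j : Matrix _ _ R) := by
    ext i j; simp
  rw [e] at h
  exact h.symm

/-- The rows interlacing with a row `r`. -/
def interlacing {n : ℕ} (r : Fin (n + 1) → ℕ) : Finset (Fin n → ℕ) :=
  Fintype.piFinset fun i => Icc (r i.castSucc) (r i.succ)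

/-- The Vandermonde determinant in the variables `X ^ (r i + i)`. -/
def rowDet {n : ℕ} (r : Fin n → ℕ) : ℤ[X] :=
  (vandermonde fun i => (X : ℤ[X]) ^ (r i + i)).det

lemma sum_Icc_pow_mul (i j l u : ℕ) (h : l ≤ u) :
    (X : ℤ[X]) ^ i * ((X ^ (j + 1) - 1) * ∑ m ∈ Icc l u, X ^ m * (X ^ (m + i)) ^ j) =
      (X ^ (u + (i + 1))) ^ (j + 1) - (X ^ (l + i)) ^ (j + 1) := by
  induction u, h using Nat.le_induction with
  | base => simp; ring
  | succ u hu ih =>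
    rw [sum_Icc_succ_top (by omega), mul_add, mul_add, ih]
    ring

lemma sum_interlacing_rowDet {n : ℕ} (r : Fin (n + 1) → ℕ) (hr : Monotone r) :
    (∑ m ∈ interlacing r, X ^ (∑ i, m i) * rowDet m) *
      ((∏ i : Fin n, X ^ (i : ℕ)) * ∏ j : Fin n, (X ^ (j + 1 : ℕ) - 1)) = rowDet r := by
  have h (m : Fin n → ℕ) : X ^ (∑ i, m i) * rowDet m =
      (of fun i j : Fin n => (X : ℤ[X]) ^ (m i) * (X ^ (m i + i)) ^ (j : ℕ)).det := by
    rw [← Finset.prod_pow_eq_pow_sum, rowDet, ← det_mul_column]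
    rfl
  simp_rw [h]
  rw [interlacing,
    sum_piFinset_det _ (fun i k j => (X : ℤ[X]) ^ k * (X ^ (k + i : ℕ)) ^ (j : ℕ)), rowDet,
    det_vandermonde_eq_det_sub_pred, mul_comm, mul_assoc, ← det_mul_row, ← det_mul_column]
  congr 1
  ext1 i j
  simpa using sum_Icc_pow_mul i j _ _ (hr (Fin.castSucc_le_succ i))

lemma rowDet_zero_succ (n : ℕ) :
    rowDet (0 : Fin (n + 1) → ℕ) = rowDet (0 : Fin n → ℕ) *
      ((∏ i : Fin n, X ^ (i : ℕ)) * ∏ j : Fin n, (X ^ (j + 1 : ℕ) - 1)) := by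
  have h : interlacing (0 : Fin (n + 1) → ℕ) = {0} := by
    ext m
    simp [interlacing, funext_iff]
  rw [← sum_interlacing_rowDet 0 monotone_const, h]
  simp

lemma rowDet_zero_ne_zero (n : ℕ) : rowDet (0 : Fin n → ℕ) ≠ 0 := by
  rw [rowDet, det_vandermonde_ne_zero_iff]
  intro i j h
  have := congrArg natDegree h
  simpa [Fin.ext_iff] using this

/-- The array `T` agrees with `T₀` off the triangle `x + y < n`, on which it is monotone. -/
def IsTriangleFilling (n : ℕ) (T₀ T : ℕ → ℕ → ℕ) : Prop :=
  (∀ x y, n ≤ x + y → T x y = T₀ x y) ∧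
    ∀ x y, x + y < n → T (x + 1) y ≤ T x y ∧ T x y ≤ T x (y + 1)

/-- The sum of the entries of `T` in the triangle `x + y < n`. -/
def triangleSum (n : ℕ) (T : ℕ → ℕ → ℕ) : ℕ :=
  ∑ y ∈ range n, ∑ x ∈ range (n - y), T x y

/-- The antidiagonal `x + y = n` of `T`. -/
def antidiag (n : ℕ) (T : ℕ → ℕ → ℕ) : Fin (n + 1) → ℕ :=
  fun y => T (n - y) y

/-- `T` with the antidiagonal `x + y = n` replaced by `m`. -/
def setAntidiag (n : ℕ) (T : ℕ → ℕ → ℕ) (m : Fin (n + 1) → ℕ) : ℕ → ℕ → ℕ :=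
  fun x y => if h : x + y = n then m ⟨y, by omega⟩ else T x y

lemma antidiag_setAntidiag (n : ℕ) (T : ℕ → ℕ → ℕ) (m : Fin (n + 1) → ℕ) :
    antidiag n (setAntidiag n T m) = m := by
  ext y
  simp [antidiag, setAntidiag, show n - (y : ℕ) + y = n by omega]

lemma triangleSum_succ (n : ℕ) (T : ℕ → ℕ → ℕ) :
    triangleSum (n + 1) T = ∑ i, antidiag n T i + triangleSum n T := by
  have h : ∑ i, antidiag n T i = ∑ y ∈ range (n + 1), T (n - y) y :=
    Fin.sum_univ_eq_sum_range (fun y => T (n - y) y) (n + 1)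
  have h' : triangleSum n T = ∑ y ∈ range (n + 1), ∑ x ∈ range (n - y), T x y := by
    simp [triangleSum, sum_range_succ]
  rw [h, h', triangleSum, ← sum_add_distrib]
  refine sum_congr rfl fun y hy => ?_
  rw [mem_range] at hy
  rw [Nat.sub_add_comm (by omega), sum_range_succ, add_comm]

lemma IsTriangleFilling.antidiag_mem {n : ℕ} {T₀ T : ℕ → ℕ → ℕ}
    (h : IsTriangleFilling (n + 1) T₀ T) : antidiag n T ∈ interlacing (antidiag (n + 1) T₀) := by
  simp only [interlacing, Fintype.mem_piFinset, mem_Icc, antidiag, Fin.val_castSucc, Fin.val_succ]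
  intro i
  have hi := i.isLt
  have := h.2 (n - i) i (by omega)
  rw [h.1 (n - i + 1) i (by omega), h.1 (n - i) (i + 1) (by omega)] at this
  rwa [Nat.sub_add_comm (by omega), Nat.add_sub_add_right]

lemma isTriangleFilling_setAntidiag {n : ℕ} {T₀ : ℕ → ℕ → ℕ} {m : Fin (n + 1) → ℕ}
    (hm : m ∈ interlacing (antidiag (n + 1) T₀)) (T : ℕ → ℕ → ℕ) :
    IsTriangleFilling n (setAntidiag n T₀ m) T ↔
      IsTriangleFilling (n + 1) T₀ T ∧ antidiag n T = m := by
  constructor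
  · rintro ⟨h1, h2⟩
    have h3 : antidiag n T = m := by
      rw [← antidiag_setAntidiag n T₀ m]
      ext y
      exact h1 _ _ (by omega)
    have h4 (x y) (hxy : n + 1 ≤ x + y) : T x y = T₀ x y := by
      rw [h1 x y (by omega), setAntidiag, dif_neg (by omega)]
    refine ⟨⟨h4, fun x y hxy => ?_⟩, h3⟩
    rcases Nat.lt_succ_iff_lt_or_eq.mp hxy with h | h
    · exact h2 x y h
    · rw [h4 (x + 1) y (by omega), h4 x (y + 1) (by omega)]
      simp only [interlacing, Fintype.mem_piFinset, mem_Icc] at hm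
      have := hm ⟨y, by omega⟩
      rw [← h3] at this
      simpa [antidiag, ← h, show x + y + 1 - y = x + 1 by omega,
        show x + y + 1 - (y + 1) = x by omega] using this
  · rintro ⟨⟨h1, h2⟩, rfl⟩
    refine ⟨fun x y hxy => ?_, fun x y hxy => h2 x y (by omega)⟩
    by_cases h : x + y = n
    · simp [setAntidiag, antidiag, ← h]
    · rw [setAntidiag, dif_neg h, h1 x y (by omega)]

/-- Weyl's formula for the generating function of the fillings of a triangle with fixed
boundary. -/
lemma sum_triangleFilling (n : ℕ) (T₀ : ℕ → ℕ → ℕ) (hT₀ : Monotone (antidiag n T₀))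
    (S : Finset (ℕ → ℕ → ℕ)) (hS : ∀ T, T ∈ S ↔ IsTriangleFilling n T₀ T) :
    (∑ T ∈ S, (X : ℤ[X]) ^ triangleSum n T) * rowDet (0 : Fin (n + 1) → ℕ) =
      rowDet (antidiag n T₀) := by
  induction n generalizing T₀ S with
  | zero =>
    have : S = {T₀} := by
      ext T
      simp [hS, IsTriangleFilling, funext_iff]
    simp [this, triangleSum, rowDet]
  | succ n ih =>
    have hfib := sum_fiberwise_of_maps_to (fun T hT => ((hS T).1 hT).antidiag_mem)
      fun T => (X : ℤ[X]) ^ triangleSum (n + 1) T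
    rw [rowDet_zero_succ (n + 1), ← mul_assoc, ← sum_interlacing_rowDet _ hT₀, ← hfib, sum_mul]
    refine congrArg (· * _) (sum_congr rfl fun m hm => ?_)
    have hmono : Monotone m := by
      simp only [interlacing, Fintype.mem_piFinset, mem_Icc] at hm
      rw [Fin.monotone_iff_le_succ]
      intro i
      exact (hm i.castSucc).2.trans (hm i.succ).1
    have key := ih (setAntidiag n T₀ m) (by rwa [antidiag_setAntidiag])
      {T ∈ S | antidiag n T = m}
      fun T => by rw [mem_filter, hS, isTriangleFilling_setAntidiag hm]
    rw [antidiag_setAntidiag] at key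
    rw [← key, ← mul_assoc, mul_sum]
    congr 1
    refine sum_congr rfl fun T hT => ?_
    rw [triangleSum_succ, (mem_filter.1 hT).2, pow_add]

lemma IsTriangleFilling.le_right {n : ℕ} {T₀ T : ℕ → ℕ → ℕ} (h : IsTriangleFilling n T₀ T)
    {x y y' : ℕ} (hy : y ≤ y') (hn : x + y' ≤ n) : T x y ≤ T x y' := by
  induction y', hy using Nat.le_induction with
  | base => rfl
  | succ k hk ih => exact (ih (by omega)).trans (h.2 x k (by omega)).2

lemma IsTriangleFilling.le_down {n : ℕ} {T₀ T : ℕ → ℕ → ℕ} (h : IsTriangleFilling n T₀ T)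
    {x x' y : ℕ} (hx : x ≤ x') (hn : x' + y ≤ n) : T x' y ≤ T x y := by
  induction x', hx using Nat.le_induction with
  | base => rfl
  | succ k hk ih => exact (h.2 k y (by omega)).1.trans (ih (by omega))

/-- The array equal to `c` in the columns `y ≥ b` and to `0` elsewhere. -/
def boxBoundary (b c : ℕ) : ℕ → ℕ → ℕ := fun _ y => if b ≤ y then c else 0

/-- An `a × b` array, with its columns reversed, extended by `boxBoundary b c`. -/
def extendBox {a b c : ℕ} (p : Fin a → Fin b → Fin (c + 1)) : ℕ → ℕ → ℕ :=
  fun x y => if h : x < a ∧ y < b then p ⟨x, h.1⟩ (Fin.rev ⟨y, h.2⟩) else boxBoundary b c x y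

/-- Arrays that decrease weakly along rows and columns. -/
def IsPlanePartition {a b c : ℕ} (p : Fin a → Fin b → Fin (c + 1)) : Prop :=
  (∀ i i' j, i ≤ i' → (p i' j : ℕ) ≤ p i j) ∧ ∀ i j j', j ≤ j' → (p i j' : ℕ) ≤ p i j

lemma extendBox_of_lt {a b c x y : ℕ} (p : Fin a → Fin b → Fin (c + 1)) (hx : x < a)
    (hy : y < b) : extendBox p x y = p ⟨x, hx⟩ (Fin.rev ⟨y, hy⟩) :=
  dif_pos ⟨hx, hy⟩

lemma extendBox_of_not {a b c x y : ℕ} (p : Fin a → Fin b → Fin (c + 1))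
    (h : ¬(x < a ∧ y < b)) : extendBox p x y = boxBoundary b c x y :=
  dif_neg h

lemma extendBox_apply {a b c : ℕ} (p : Fin a → Fin b → Fin (c + 1)) (i : Fin a) (j : Fin b) :
    extendBox p i (j.rev : ℕ) = p i j := by
  rw [extendBox_of_lt p i.isLt j.rev.isLt, Fin.eta, Fin.eta, Fin.rev_rev]

lemma extendBox_injective (a b c : ℕ) :
    Function.Injective (extendBox : (Fin a → Fin b → Fin (c + 1)) → ℕ → ℕ → ℕ) := by
  intro p p' h
  ext i j
  rw [← extendBox_apply p, ← extendBox_apply p', h]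

lemma isTriangleFilling_extendBox {a b c : ℕ} {p : Fin (a + 1) → Fin b → Fin (c + 1)}
    (hp : IsPlanePartition p) :
    IsTriangleFilling (b + a) (boxBoundary b c) (extendBox p) := by
  refine ⟨fun x y hxy => extendBox_of_not p (by omega), fun x y hxy => ⟨?_, ?_⟩⟩
  · by_cases h : x + 1 < a + 1 ∧ y < b
    · rw [extendBox_of_lt p h.1 h.2, extendBox_of_lt p (x := x) (by omega) h.2]
      exact hp.1 _ _ _ (by simp [Fin.le_def])
    · rw [extendBox_of_not p h]
      by_cases hy : b ≤ y
      · rw [extendBox_of_not p (by omega)]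
        rfl
      · simp [boxBoundary, hy]
  · by_cases h : x < a + 1 ∧ y < b
    · rw [extendBox_of_lt p h.1 h.2]
      by_cases hy : y + 1 < b
      · rw [extendBox_of_lt p h.1 hy]
        refine hp.2 _ _ _ ?_
        simp only [Fin.le_def, Fin.val_rev]
        omega
      · rw [extendBox_of_not p (by omega), boxBoundary, if_pos (by omega)]
        exact Fin.is_le _
    · rw [extendBox_of_not p h, extendBox_of_not p (y := y + 1) (by omega)]
      simp only [boxBoundary]
      split_ifs <;> omega

lemma IsTriangleFilling.exists_extendBox {a b c : ℕ} {T : ℕ → ℕ → ℕ}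
    (h : IsTriangleFilling (b + a) (boxBoundary b c) T) :
    ∃ p : Fin (a + 1) → Fin b → Fin (c + 1), IsPlanePartition p ∧ extendBox p = T := by
  have hc (x y) (hx : x + y ≤ b + a) : T x y ≤ c := by
    refine (h.le_right (y' := b + a - x) (by omega) (by omega)).trans ?_
    rw [h.1 _ _ (by omega), boxBoundary]
    split_ifs <;> omega
  refine ⟨fun i j => ⟨T i j.rev, Nat.lt_succ_of_le (hc _ _ ?_)⟩, ⟨?_, ?_⟩, ?_⟩
  · rw [Fin.val_rev]; omega
  · intro i i' j hi
    exact h.le_down hi (by rw [Fin.val_rev]; omega)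
  · intro i j j' hj
    refine h.le_right ?_ (by rw [Fin.val_rev]; omega)
    simp only [Fin.val_rev, Fin.le_def] at hj ⊢
    omega
  · ext x y
    by_cases hxy : x < a + 1 ∧ y < b
    · simp [extendBox, hxy]
    · rw [extendBox, dif_neg hxy]
      by_cases hn : b + a ≤ x + y
      · rw [h.1 x y hn]
      · by_cases hy : b ≤ y
        · have := h.le_down (x := x) (x' := b + a - y) (y := y) (by omega) (by omega)
          rw [h.1 (b + a - y) y (by omega)] at this
          have := hc x y (by omega)
          simp only [boxBoundary, hy, if_true] at *
          omega
        · have := h.le_right (x := x) (y := y) (y' := b + a - x) (by omega) (by omega)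
          rw [h.1 x (b + a - x) (by omega), boxBoundary, if_neg (by omega)] at this
          rw [boxBoundary, if_neg hy]
          omega

lemma triangleSum_extendBox {a b c : ℕ} (p : Fin (a + 1) → Fin b → Fin (c + 1)) :
    triangleSum (b + a) (extendBox p) =
      ∑ j ∈ range (a + 1), c * j + ∑ i, ∑ j, (p i j : ℕ) := by
  rw [triangleSum, sum_range_add, add_comm]
  congr 1
  · rw [← sum_range_reflect (fun j => c * j), sum_range_succ]
    simp only [Nat.add_sub_cancel, Nat.sub_self, mul_zero, add_zero]
    refine sum_congr rfl fun y _ => ?_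
    rw [Nat.add_sub_add_left, sum_congr rfl (g := fun _ => c)]
    · simp [mul_comm]
    · intro x _
      simp [extendBox, boxBoundary]
  · have h (y : ℕ) (hy : y ∈ range b) :
        ∑ x ∈ range (b + a - y), extendBox p x y = ∑ i : Fin (a + 1), extendBox p i y := by
      rw [mem_range] at hy
      rw [Fin.sum_univ_eq_sum_range (fun x => extendBox p x y)]
      refine (sum_subset (range_mono (by omega)) fun x _ hx => ?_).symm
      rw [mem_range] at hx
      rw [extendBox_of_not p (by omega), boxBoundary, if_neg (by omega)]
    rw [sum_congr rfl h, sum_comm]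
    refine sum_congr rfl fun i _ => ?_
    rw [← Fin.sum_univ_eq_sum_range, ← Equiv.sum_comp Fin.revPerm]
    exact sum_congr rfl fun j _ => extendBox_apply p i j

lemma rowDet_eq_prod {n : ℕ} (f : ℕ → ℕ) :
    rowDet (fun i : Fin n => f i) =
      ∏ j ∈ range n, ∏ i ∈ range j, ((X : ℤ[X]) ^ (f j + j) - X ^ (f i + i)) := by
  rw [rowDet, det_vandermonde, ← Fin.prod_univ_eq_prod_range
    (fun j => ∏ i ∈ range j, ((X : ℤ[X]) ^ (f j + j) - X ^ (f i + i)))]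
  rw [prod_comm' (t' := univ) (s' := fun j => Iio j) (by simp)]
  refine prod_congr rfl fun j _ => ?_
  rw [← Nat.Iio_eq_range, ← Fin.map_valEmbedding_Iio, prod_map]
  rfl

/-- Evaluation of the Vandermonde determinant of the boundary row of a box. -/
lemma exists_rowDet_box {n a b : ℕ} (hn : n = b + a) : ∃ N : ℤ[X], ∀ c : ℕ,
    rowDet (fun i : Fin n => if b ≤ (i : ℕ) then c else 0) =
      N * (X ^ (∑ j ∈ range a, c * j) *
        ∏ j ∈ range a, ∏ i ∈ range b, (1 - X ^ (j + i + c + 1))) := by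
  refine ⟨(∏ j ∈ range b, ∏ i ∈ range j, (X ^ j - X ^ i)) *
    (∏ j ∈ range a, ∏ i ∈ range b, -X ^ (b - 1 - i)) *
    ∏ j ∈ range a, ∏ i ∈ range j, (X ^ (b + j) - X ^ (b + i)), fun c => ?_⟩
  rw [rowDet_eq_prod (fun i => if b ≤ i then c else 0), hn, prod_range_add]
  have h1 : ∏ j ∈ range b, ∏ i ∈ range j, ((X : ℤ[X]) ^ ((if b ≤ j then c else 0) + j) -
      X ^ ((if b ≤ i then c else 0) + i)) = ∏ j ∈ range b, ∏ i ∈ range j, (X ^ j - X ^ i) := by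
    refine prod_congr rfl fun j hj => prod_congr rfl fun i hi => ?_
    rw [mem_range] at hi hj
    rw [if_neg (by omega), if_neg (by omega), zero_add, zero_add]
  have h2 (j : ℕ) : ∏ i ∈ range (b + j), ((X : ℤ[X]) ^ ((if b ≤ b + j then c else 0) + (b + j)) -
      X ^ ((if b ≤ i then c else 0) + i)) =
      ((∏ i ∈ range b, -X ^ (b - 1 - i)) * ∏ i ∈ range b, (1 - X ^ (j + i + c + 1))) *
      (X ^ (c * j) * ∏ i ∈ range j, (X ^ (b + j) - X ^ (b + i))) := by
    rw [prod_range_add, ← prod_range_reflect, ← prod_mul_distrib]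
    congr 1
    · refine prod_congr rfl fun i hi => ?_
      rw [mem_range] at hi
      rw [if_pos (by omega), if_neg (by omega), mul_sub, zero_add, neg_mul, neg_mul, ← pow_add,
        show c + (b + j) = b - 1 - i + (j + i + c + 1) by omega]
      ring
    · rw [pow_mul, ← card_range j, ← prod_const, card_range, ← prod_mul_distrib]
      refine prod_congr rfl fun i hi => ?_
      rw [if_pos (by omega), if_pos (by omega)]
      ring
  rw [h1, prod_congr rfl fun j _ => h2 j]
  simp only [prod_mul_distrib, prod_pow_eq_pow_sum]
  ring

lemma prod_range_shift_mul (i c : ℕ) :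
    (∏ k ∈ range c, (1 - (X : ℤ[X]) ^ (i + k + 1))) * (1 - X ^ (i + c + 1)) =
      (∏ k ∈ range c, (1 - X ^ (i + k + 2))) * (1 - X ^ (i + 1)) := by
  induction c with
  | zero => simp
  | succ c ih =>
    rw [prod_range_succ, ih, prod_range_succ]
    ring

/-- MacMahon's formula, with the product over the height of the box telescoped. -/
lemma sum_planePartition (a b c : ℕ)
    [Fintype {π : Fin a → Fin b → Fin (c + 1) // IsPlanePartition π}] :
    (∑ π : {π : Fin a → Fin b → Fin (c + 1) // IsPlanePartition π},
      (X : ℤ[X]) ^ (∑ i, ∑ j, (π.val i j : ℕ))) *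
      (∏ i ∈ range a, ∏ j ∈ range b, (1 - X ^ (i + j + 1))) =
      ∏ i ∈ range a, ∏ j ∈ range b, (1 - X ^ (i + j + c + 1)) := by
  cases a with
  | zero =>
    have : Unique {π : Fin 0 → Fin b → Fin (c + 1) // IsPlanePartition π} :=
      ⟨⟨⟨fun i => i.elim0, fun i => i.elim0, fun i => i.elim0⟩⟩,
        fun p => Subtype.ext (funext fun i => i.elim0)⟩
    simp
  | succ a =>
    obtain ⟨N, hN⟩ := exists_rowDet_box (n := b + a + 1) (a := a + 1) (b := b) rfl
    have hdiag : antidiag (b + a) (boxBoundary b c) =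
      fun i : Fin (b + a + 1) => if b ≤ (i : ℕ) then c else 0 := rfl
    have key := sum_triangleFilling (b + a) (boxBoundary b c)
      (by
        intro i j hij
        have : (i : ℕ) ≤ j := hij
        simp only [antidiag, boxBoundary]
        split_ifs <;> omega)
      (univ.image fun π : {π : Fin (a + 1) → Fin b → Fin (c + 1) // IsPlanePartition π} =>
        extendBox π.val)
      (fun T => by
        simp only [mem_image, mem_univ, true_and, Subtype.exists, exists_prop]
        constructor
        · rintro ⟨p, hp, rfl⟩
          exact isTriangleFilling_extendBox hp
        · exact fun h => h.exists_extendBox)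
    have hzero := hN 0
    simp only [ite_self, zero_mul, sum_const_zero, pow_zero, one_mul, add_zero] at hzero
    rw [show (fun _ : Fin (b + a + 1) => 0) = 0 from rfl] at hzero
    have hN0 : N ≠ 0 := left_ne_zero_of_mul (hzero ▸ rowDet_zero_ne_zero (b + a + 1))
    rw [sum_image fun p _ p' _ h => Subtype.ext (extendBox_injective _ _ _ h), hdiag, hN, hzero]
      at key
    simp only [triangleSum_extendBox, pow_add _ (∑ j ∈ range (a + 1), c * j), ← mul_sum] at key
    refine mul_left_cancel₀ (mul_ne_zero hN0
      (pow_ne_zero (∑ j ∈ range (a + 1), c * j) (X_ne_zero (R := ℤ)))) ?_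
    rw [mul_assoc N _ (∏ i ∈ _, _), ← key]
    ring

/-- The `q`-analogue of MacMahon's formula: the generating function `Σ_P q^{|P|}` over
plane partitions `P` inside the box `B(a,b,c)` — i.e. `a × b` arrays of integers in
`[0, c]`, weakly decreasing along rows and columns, `|P|` being the sum of the entries —
equals `∏_{i=1}^a ∏_{j=1}^b ∏_{k=1}^c (1 - q^{i+j+k-1})/(1 - q^{i+j+k-2})`, stated here
with denominators cleared. -/
theorem macmahon_q_formula (a b c : ℕ) :
    (∑ π : {π : Fin a → Fin b → Fin (c + 1) //
        (∀ i i' j, i ≤ i' → (π i' j : ℕ) ≤ π i j) ∧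
        ∀ i j j', j ≤ j' → (π i j' : ℕ) ≤ π i j},
        (Polynomial.X : Polynomial ℤ) ^ (∑ i, ∑ j, (π.val i j : ℕ))) *
      (∏ i ∈ Finset.range a, ∏ j ∈ Finset.range b, ∏ k ∈ Finset.range c,
        (1 - (Polynomial.X : Polynomial ℤ) ^ (i + j + k + 1))) =
    ∏ i ∈ Finset.range a, ∏ j ∈ Finset.range b, ∏ k ∈ Finset.range c,
      (1 - (Polynomial.X : Polynomial ℤ) ^ (i + j + k + 2)) := by
  have hD : (∏ i ∈ range a, ∏ j ∈ range b, (1 - (X : ℤ[X]) ^ (i + j + 1))) ≠ 0 := by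
    refine prod_ne_zero_iff.2 fun i _ => prod_ne_zero_iff.2 fun j _ h => ?_
    simpa using congrArg (eval 0) h
  refine mul_right_cancel₀ hD ?_
  have h := @sum_planePartition a b c
  unfold IsPlanePartition at h
  rw [mul_right_comm, h]
  simp only [← prod_mul_distrib]
  refine prod_congr rfl fun i _ => prod_congr rfl fun j _ => ?_
  rw [mul_comm, prod_range_shift_mul]

end
end
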